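/- arXiv:0807.2689 — 3 statements merged into one kernel-verified Lean document; each statement's English description precedes it below -/
import Mathlib

section
/- Let q be an odd prime power, let d ≥ 2 be an integer, and let t ∈ 𝔽_q with t ≠ 0. Then the number of ordered pairs (x, y) ∈ 𝔽_q^d × 𝔽_q^d with ‖x − y‖ = t differs from q^{2d−1} by at most 2·q^{(3d−1)/2}. -/
open Finset
open scoped Classical

section SumsOfSquares

variable {K : Type*} [Field K] [Fintype K]

/-- Sums over squares, weighted by the number of square roots. -/
theorem sum_comp_sq (hK : ringChar K ≠ 2) (f : K → ℤ) :
    ∑ x : K, f (x ^ 2) = ∑ a : K, (quadraticChar K a + 1) * f a := by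
  rw [← Finset.sum_fiberwise univ (fun x : K => x ^ 2) (fun x => f (x ^ 2))]
  refine Finset.sum_congr rfl fun a _ => ?_
  rw [← quadraticChar_card_sqrts hK a, Finset.sum_congr rfl (g := fun _ => f a)
    (fun x hx => by rw [(Finset.mem_filter.mp hx).2]), Finset.sum_const, nsmul_eq_mul]
  congr 3
  ext x
  simp

/-- The additive autocorrelation of the quadratic character. -/
theorem sum_quadraticChar_mul_quadraticChar_sub (hK : ringChar K ≠ 2) (u : K) :
    ∑ a : K, quadraticChar K a * quadraticChar K (u - a) =
      quadraticChar K (-1) * ((if u = 0 then (Fintype.card K : ℤ) else 0) - 1) := by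
  split_ifs with hu
  · subst hu
    have h (a : K) : quadraticChar K a * quadraticChar K (0 - a) =
        quadraticChar K (-1) * (1 - if a = 0 then 1 else 0) := by
      split_ifs with ha
      · simp [ha]
      · have := quadraticChar_sq_one ha
        rw [show (0 : K) - a = -1 * a by ring, map_mul]
        linear_combination quadraticChar K (-1) * this
    simp only [h, ← Finset.mul_sum, Finset.sum_sub_distrib]
    simp
  · rw [← Equiv.sum_comp (Equiv.mulLeft₀ u hu)]
    have h (b : K) : quadraticChar K (u * b) * quadraticChar K (u - u * b) =
        quadraticChar K b * quadraticChar K (1 - b) := by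
      rw [show u - u * b = u * (1 - b) by ring, map_mul, map_mul]
      linear_combination
        quadraticChar K b * quadraticChar K (1 - b) * quadraticChar_sq_one hu
    have hJ := jacobiSum_nontrivial_inv (quadraticChar_ne_one hK)
    rw [MulChar.IsQuadratic.inv (quadraticChar_isQuadratic K), jacobiSum] at hJ
    simp only [Equiv.mulLeft₀_apply, h, hJ]
    ring

/-- Averaging a function over sums of two squares. -/
theorem sum_sum_comp_sq_add_sq (hK : ringChar K ≠ 2) (f : K → ℤ) :
    ∑ x : K, ∑ y : K, f (x ^ 2 + y ^ 2) =
      (Fintype.card K - quadraticChar K (-1)) * ∑ u : K, f u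
        + Fintype.card K * quadraticChar K (-1) * f 0 := by
  have hweight (u : K) :
      ∑ a : K, (quadraticChar K a + 1) * (quadraticChar K (u - a) + 1) =
        Fintype.card K + quadraticChar K (-1) *
          ((if u = 0 then (Fintype.card K : ℤ) else 0) - 1) := by
    have hshift : ∑ a : K, quadraticChar K (u - a) = 0 := by
      rw [← quadraticChar_sum_zero hK]
      exact (Equiv.subLeft u).sum_comp (fun a => quadraticChar K a)
    simp only [add_mul, mul_add, one_mul, mul_one, Finset.sum_add_distrib,
      sum_quadraticChar_mul_quadraticChar_sub hK, quadraticChar_sum_zero hK, hshift]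
    simp
    ring
  calc
    _ = ∑ x : K, ∑ b : K, (quadraticChar K b + 1) * f (x ^ 2 + b) :=
      Finset.sum_congr rfl fun x _ => sum_comp_sq hK (fun b => f (x ^ 2 + b))
    _ = ∑ a : K, (quadraticChar K a + 1) * ∑ b : K, (quadraticChar K b + 1) * f (a + b) :=
      sum_comp_sq hK (fun a => ∑ b : K, (quadraticChar K b + 1) * f (a + b))
    _ = ∑ a : K, ∑ u : K, (quadraticChar K a + 1) * (quadraticChar K (u - a) + 1) * f u := by
      refine Finset.sum_congr rfl fun a _ => ?_
      rw [Finset.mul_sum, ← (Equiv.subRight a).sum_comp]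
      refine Finset.sum_congr rfl fun u _ => ?_
      simp only [Equiv.subRight_apply, add_sub_cancel]
      ring
    _ = ∑ u : K, (Fintype.card K + quadraticChar K (-1) *
          ((if u = 0 then (Fintype.card K : ℤ) else 0) - 1)) * f u := by
      rw [Finset.sum_comm]
      simp only [← Finset.sum_mul, hweight]
    _ = ∑ u : K, ((Fintype.card K - quadraticChar K (-1)) * f u +
          if u = 0 then Fintype.card K * quadraticChar K (-1) * f u else 0) := by
      refine Finset.sum_congr rfl fun u _ => ?_
      split_ifs <;> ring
    _ = _ := by
      rw [Finset.sum_add_distrib, ← Finset.mul_sum]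
      simp

/-- The number of points on the sphere of squared radius `t` in `K ^ d`. -/
noncomputable def sphereCard (K : Type*) [Field K] [Fintype K] (d : ℕ) (t : K) : ℕ :=
  (univ.filter fun z : Fin d → K => ∑ i, z i ^ 2 = t).card

theorem sum_sphereCard (d : ℕ) : ∑ t : K, sphereCard K d t = Fintype.card K ^ d := by
  have h := Finset.card_eq_sum_card_fiberwise (s := univ) (t := univ)
    (f := fun z : Fin d → K => ∑ i, z i ^ 2) (fun _ _ => by simp)
  simpa [sphereCard] using h.symm

theorem sphereCard_zero {t : K} (ht : t ≠ 0) : sphereCard K 0 t = 0 := by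
  simp [sphereCard, ht.symm]

theorem sphereCard_succ (d : ℕ) (t : K) :
    sphereCard K (d + 1) t = ∑ x : K, sphereCard K d (t - x ^ 2) := by
  simp only [sphereCard, Finset.card_filter]
  rw [← (Fin.consEquiv fun _ => K).sum_comp, Fintype.sum_prod_type]
  simp [Fin.consEquiv, Fin.sum_univ_succ, eq_sub_iff_add_eq']

theorem sphereCard_one (hK : ringChar K ≠ 2) (t : K) :
    (sphereCard K 1 t : ℤ) = quadraticChar K t + 1 := by
  have h := sum_comp_sq hK fun a => if a = t then 1 else 0
  rw [sphereCard_succ]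
  have hzero (x : K) : sphereCard K 0 (t - x ^ 2) = if x ^ 2 = t then 1 else 0 := by
    split_ifs with hx
    · simp [sphereCard, hx]
    · exact sphereCard_zero (sub_ne_zero.mpr (Ne.symm hx))
  simpa [hzero] using h

theorem sphereCard_add_two (hK : ringChar K ≠ 2) (d : ℕ) (t : K) :
    (sphereCard K (d + 2) t : ℤ) =
      (Fintype.card K - quadraticChar K (-1)) * (Fintype.card K : ℤ) ^ d
        + Fintype.card K * quadraticChar K (-1) * sphereCard K d t := by
  have h := sum_sum_comp_sq_add_sq hK fun u => (sphereCard K d (t - u) : ℤ)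
  have hsum : ∑ u : K, (sphereCard K d (t - u) : ℤ) = (Fintype.card K : ℤ) ^ d := by
    refine ((Equiv.subLeft t).sum_comp fun u => (sphereCard K d u : ℤ)).trans ?_
    exact_mod_cast sum_sphereCard (K := K) d
  rw [hsum, sub_zero] at h
  simp only [← h, sphereCard_succ, Nat.cast_sum, sub_sub]

/-- The sphere of nonzero squared radius has `q ^ (d - 1)` points up to `q ^ ((d - 1) / 2)`. -/
theorem abs_sphereCard_sub_le (hK : ringChar K ≠ 2) {t : K} (ht : t ≠ 0) (d : ℕ) :
    |(sphereCard K d t : ℝ) - (Fintype.card K : ℝ) ^ d / Fintype.card K| ≤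
      (Fintype.card K : ℝ) ^ (((d : ℝ) - 1) / 2) := by
  have hq : (1 : ℝ) ≤ Fintype.card K := by exact_mod_cast Fintype.card_pos
  have hq0 : (0 : ℝ) < Fintype.card K := by linarith
  induction d using Nat.twoStepInduction with
  | zero =>
    rw [sphereCard_zero ht, Nat.cast_zero, pow_zero, zero_sub, abs_neg,
      abs_of_nonneg (by positivity), one_div, ← Real.rpow_neg_one]
    exact Real.rpow_le_rpow_of_exponent_le hq (by norm_num)
  | one =>
    have h : (sphereCard K 1 t : ℝ) = quadraticChar K t + 1 := by
      exact_mod_cast sphereCard_one hK t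
    rcases quadraticChar_dichotomy ht with hχ | hχ <;> simp [h, hχ, hq0.ne']
  | more d ih _ =>
    have h : (sphereCard K (d + 2) t : ℝ) =
        (Fintype.card K - quadraticChar K (-1)) * (Fintype.card K : ℝ) ^ d
          + Fintype.card K * quadraticChar K (-1) * sphereCard K d t := by
      exact_mod_cast sphereCard_add_two hK d t
    have hε : |((quadraticChar K (-1) : ℤ) : ℝ)| = 1 := by
      rcases quadraticChar_dichotomy (neg_ne_zero.mpr (one_ne_zero (α := K))) with hχ | hχ <;>
        simp [hχ]
    have hrec : (sphereCard K (d + 2) t : ℝ) - (Fintype.card K : ℝ) ^ (d + 2) / Fintype.card K =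
        quadraticChar K (-1) * (Fintype.card K *
          (sphereCard K d t - (Fintype.card K : ℝ) ^ d / Fintype.card K)) := by
      rw [h]
      field_simp
      ring
    rw [hrec, abs_mul, hε, one_mul, abs_mul, abs_of_pos hq0,
      show (((d + 2 : ℕ) : ℝ) - 1) / 2 = 1 + ((d : ℝ) - 1) / 2 by push_cast; ring,
      Real.rpow_add hq0, Real.rpow_one]
    gcongr

/-- Translating by the second point reduces pairs at a fixed distance to a sphere. -/
theorem card_filter_sum_sub_sq_eq (d : ℕ) (t : K) :
    (univ.filter fun p : (Fin d → K) × (Fin d → K) => ∑ i, (p.1 i - p.2 i) ^ 2 = t).card =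
      Fintype.card K ^ d * sphereCard K d t := by
  simp only [sphereCard, Finset.card_filter]
  rw [Fintype.sum_prod_type_right]
  have h (y : Fin d → K) : (∑ x : Fin d → K, if ∑ i, (x i - y i) ^ 2 = t then 1 else 0) =
      ∑ z : Fin d → K, if ∑ i, z i ^ 2 = t then 1 else 0 :=
    (Equiv.subRight y).sum_comp fun z : Fin d → K => if ∑ i, z i ^ 2 = t then 1 else 0
  simp [h]

end SumsOfSquares

/-- For an odd prime power `q`, `d ≥ 2`, and `t ∈ 𝔽_q` with `t ≠ 0`,
the number of ordered pairs `(x, y) ∈ 𝔽_q^d × 𝔽_q^d` with `‖x - y‖ = t` differs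
from `q^(2d-1)` by at most `2 q^((3d-1)/2)`. -/
theorem pair_distance_count (q d : ℕ) (hq : IsPrimePow q) (hodd : Odd q) (hd : 2 ≤ d)
    (K : Type) [Field K] [Fintype K] (hcard : Fintype.card K = q)
    (t : K) (ht : t ≠ 0) :
    |((Finset.univ.filter (fun p : (Fin d → K) × (Fin d → K) =>
          ∑ i, (p.1 i - p.2 i) ^ 2 = t)).card : ℝ)
        - (q : ℝ) ^ (2 * d - 1)|
      ≤ 2 * (q : ℝ) ^ ((3 * (d : ℝ) - 1) / 2) := by
  have hK : ringChar K ≠ 2 := fun h => by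
    have := FiniteField.even_card_of_char_two h
    rw [hcard] at this
    exact (Nat.not_even_iff_odd.mpr hodd) (Nat.even_iff.mpr this)
  have hq0 : (0 : ℝ) < q := by exact_mod_cast hq.pos
  have hsphere := abs_sphereCard_sub_le hK ht d
  rw [hcard] at hsphere
  have hpow : (q : ℝ) ^ (2 * d - 1) = (q : ℝ) ^ d * ((q : ℝ) ^ d / q) := by
    rw [← mul_div_assoc, ← pow_add, eq_div_iff hq0.ne', ← pow_succ]
    congr 1
    omega
  rw [card_filter_sum_sub_sq_eq, hcard, Nat.cast_mul, Nat.cast_pow, hpow, ← mul_sub, abs_mul,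
    abs_of_nonneg (by positivity)]
  calc
    _ ≤ (q : ℝ) ^ d * (q : ℝ) ^ (((d : ℝ) - 1) / 2) := by gcongr
    _ = (q : ℝ) ^ ((3 * (d : ℝ) - 1) / 2) := by
      rw [← Real.rpow_natCast, ← Real.rpow_add hq0]
      congr 1
      ring
    _ ≤ _ := le_mul_of_one_le_left (by positivity) one_le_two
end

section
/- Let q be an odd prime power and let d ≥ 3 be an integer. Then the number of ordered pairs (x, y) ∈ 𝔽_q^d × 𝔽_q^d with x ≠ y and ‖x − y‖ = 0 differs from q^{2d−1} by at most 2·q^{3d/2}. -/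
open Finset
open scoped Classical

theorem norm_sum_addChar_mul_sq {F : Type*} [Field F] [Fintype F] (hF : (2 : F) ≠ 0)
    {ψ : AddChar F ℂ} (hψ : ψ.IsPrimitive) {s : F} (hs : s ≠ 0) :
    ‖∑ x, ψ (s * x ^ 2)‖ = √(Fintype.card F) := by
  have key : (∑ x, ψ (s * x ^ 2)) * (starRingEnd ℂ) (∑ y, ψ (s * y ^ 2)) = Fintype.card F := by
    calc
      _ = ∑ y, ∑ x, ψ (s * x ^ 2) * ψ (-(s * y ^ 2)) := by
        simp_rw [map_sum, ← AddChar.map_neg_eq_conj, Finset.sum_mul_sum]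
        exact Finset.sum_comm
      _ = ∑ y, ∑ u, ψ (s * u ^ 2) * ψ (y * (2 * s * u)) := by
        refine Finset.sum_congr rfl fun y _ => ?_
        rw [← Equiv.sum_comp (Equiv.addRight y)]
        refine Finset.sum_congr rfl fun u _ => ?_
        rw [← AddChar.map_add_eq_mul, ← AddChar.map_add_eq_mul]
        congr 1
        simp only [Equiv.coe_addRight]
        ring
      _ = ∑ u, ψ (s * u ^ 2) * ∑ y, ψ (y * (2 * s * u)) := by
        rw [Finset.sum_comm]
        simp_rw [Finset.mul_sum]
      _ = _ := by
        simp [AddChar.sum_mulShift _ hψ, hF, hs]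
  rw [Complex.mul_conj, Complex.normSq_eq_norm_sq] at key
  rw [← Real.sqrt_sq (norm_nonneg (∑ x, ψ (s * x ^ 2)))]
  congr 1
  exact_mod_cast key

theorem abs_card_sum_sq_eq_zero_sub_le {F : Type*} [Field F] [Fintype F] (hF : (2 : F) ≠ 0)
    (d : ℕ) :
    |(Fintype.card F : ℝ) * #{x : Fin d → F | ∑ i, x i ^ 2 = 0} - (Fintype.card F : ℝ) ^ d|
      ≤ Fintype.card F * √(Fintype.card F) ^ d := by
  obtain ⟨ψ, hψ⟩ : ∃ ψ : AddChar F ℂ, ψ.IsPrimitive := by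
    obtain ⟨ψ, hψ⟩ := AddChar.exists_apply_ne_zero.2 (one_ne_zero (α := F))
    exact ⟨ψ, .of_ne_one (AddChar.ne_one_iff.2 ⟨1, hψ⟩)⟩
  have key : (Fintype.card F : ℂ) * #{x : Fin d → F | ∑ i, x i ^ 2 = 0} - (Fintype.card F : ℂ) ^ d
      = ∑ s ∈ univ.erase (0 : F), (∑ x, ψ (s * x ^ 2)) ^ d := by
    rw [Finset.sum_erase_eq_sub (mem_univ _)]
    congr 1
    · calc
        _ = ∑ x : Fin d → F, ∑ s, ψ (s * ∑ i, x i ^ 2) := by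
          simp [AddChar.sum_mulShift _ hψ, Finset.sum_ite, mul_comm]
        _ = _ := by
          rw [Finset.sum_comm]
          refine Finset.sum_congr rfl fun s _ => ?_
          rw [← Fin.prod_const, Finset.prod_univ_sum, Fintype.piFinset_univ]
          refine Finset.sum_congr rfl fun x _ => ?_
          rw [Finset.mul_sum]
          exact map_prod ψ.toMonoidHom (fun i => Multiplicative.ofAdd (s * x i ^ 2)) univ
    · simp
  calc
    _ = ‖∑ s ∈ univ.erase (0 : F), (∑ x, ψ (s * x ^ 2)) ^ d‖ := by
      rw [← key, ← Real.norm_eq_abs, ← Complex.norm_real]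
      push_cast
      rfl
    _ ≤ ∑ s ∈ univ.erase (0 : F), √(Fintype.card F) ^ d := by
      refine norm_sum_le_of_le _ fun s hs => ?_
      rw [norm_pow, norm_sum_addChar_mul_sq hF hψ (Finset.ne_of_mem_erase hs)]
    _ ≤ ∑ s : F, √(Fintype.card F) ^ d :=
      Finset.sum_le_sum_of_subset_of_nonneg (Finset.erase_subset _ _) fun _ _ _ => by positivity
    _ = _ := by simp

theorem card_filter_sub {G : Type*} [AddGroup G] [Fintype G] (P : G → Prop) [DecidablePred P] :
    #{p : G × G | P (p.1 - p.2)} = Fintype.card G * #{x : G | P x} := by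
  rw [← Finset.card_univ, mul_comm, ← Finset.card_product]
  refine Finset.card_bij' (fun p _ => (p.1 - p.2, p.2)) (fun p _ => (p.1 + p.2, p.2)) ?_ ?_ ?_ ?_
    <;> simp

/-- For an odd prime power `q` and `d ≥ 3`, the number of ordered pairs
`(x, y) ∈ 𝔽_q^d × 𝔽_q^d` with `x ≠ y` and `‖x - y‖ = 0` differs from `q^(2d-1)`
by at most `2 q^(3d/2)`. -/
theorem null_pair_count (q d : ℕ) (hq : IsPrimePow q) (hodd : Odd q) (hd : 3 ≤ d)
    (K : Type) [Field K] [Fintype K] (hcard : Fintype.card K = q) :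
    |((Finset.univ.filter (fun p : (Fin d → K) × (Fin d → K) =>
          p.1 ≠ p.2 ∧ ∑ i, (p.1 i - p.2 i) ^ 2 = 0)).card : ℝ)
        - (q : ℝ) ^ (2 * d - 1)|
      ≤ 2 * (q : ℝ) ^ ((3 * (d : ℝ)) / 2) := by
  have h2 : (2 : K) ≠ 0 := by
    apply Ring.two_ne_zero
    intro h
    have := FiniteField.even_card_iff_char_two.1 h
    rw [hcard] at this
    exact absurd (Nat.odd_iff.1 hodd) (by omega)
  have hcount : (#{p : (Fin d → K) × (Fin d → K) |
      p.1 ≠ p.2 ∧ ∑ i, (p.1 i - p.2 i) ^ 2 = 0} : ℝ)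
      = q ^ d * (#{x : Fin d → K | ∑ i, x i ^ 2 = 0} - 1) := by
    have h := card_filter_sub (fun x : Fin d → K => x ≠ 0 ∧ ∑ i, x i ^ 2 = 0)
    have herase : ({x : Fin d → K | x ≠ 0 ∧ ∑ i, x i ^ 2 = 0} : Finset _)
        = ({x : Fin d → K | ∑ i, x i ^ 2 = 0} : Finset _).erase 0 := by
      ext; simp
    rw [herase] at h
    simp only [sub_ne_zero, Pi.sub_apply] at h
    rw [h, Nat.cast_mul, Finset.cast_card_erase_of_mem (by simp)]
    simp [hcard]
  have hN := abs_card_sum_sq_eq_zero_sub_le h2 d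
  rw [hcard] at hN
  rw [hcount]
  generalize (#{x : Fin d → K | ∑ i, x i ^ 2 = 0} : ℝ) = N at hN
  have hq1 : (1 : ℝ) ≤ q := by exact_mod_cast hq.one_lt.le
  have hq0 : (0 : ℝ) < q := by linarith
  have hpow : (q : ℝ) ^ ((3 * (d : ℝ)) / 2) = q ^ d * √q ^ d := by
    rw [Real.sqrt_eq_rpow, ← Real.rpow_natCast, ← Real.rpow_natCast, ← Real.rpow_mul hq0.le,
      ← Real.rpow_add hq0]
    ring_nf
  have hsqrt : 1 ≤ √(q : ℝ) ^ d := one_le_pow₀ (Real.one_le_sqrt.2 hq1)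
  obtain ⟨e, rfl⟩ : ∃ e, d = e + 1 := ⟨d - 1, by omega⟩
  have hN' : |N - (q : ℝ) ^ e| ≤ √q ^ (e + 1) := by
    rw [pow_succ' (q : ℝ), ← mul_sub, abs_mul, abs_of_pos hq0] at hN
    exact le_of_mul_le_mul_left hN hq0
  have hexp : 2 * (e + 1) - 1 = (e + 1) + e := by omega
  rw [hpow, hexp, pow_add (q : ℝ) (e + 1) e, ← mul_sub, abs_mul, abs_of_pos (by positivity),
    mul_left_comm]
  gcongr
  rw [abs_le] at hN' ⊢
  constructor <;> linarith
end

section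
/- Let q be an odd prime power, let d ≥ 2 be an integer, let Q be a nondegenerate quadratic form on 𝔽_q^d, and let a ∈ 𝔽_q with a ≠ 0. Let G be the graph with vertex set 𝔽_q^d in which x and y are adjacent iff x ≠ y and Q(x − y) = a, and let A be its adjacency matrix (a real symmetric q^d × q^d matrix). Then for every real vector v indexed by 𝔽_q^d whose coordinates sum to 0, one has ‖A v‖ ≤ 2·q^{(d−1)/2}·‖v‖; i.e., every eigenvalue of A other than the valency has absolute value at most 2·q^{(d−1)/2}. -/
open Finset
open scoped Classical

section Stepanov

open Polynomial

variable {L : Type*} [Field L]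

/-- The `L`-linear map sending `X ^ n` to `X ^ (r * (n / r))` if `n % r = i` and to `0` otherwise,
so that `p` is the sum of the `X ^ i * blockPart r i p` over `i < r`. -/
noncomputable def blockPart (r i : ℕ) : L[X] →ₗ[L] L[X] :=
  Polynomial.lsum fun n => if n % r = i then Polynomial.monomial (r * (n / r)) else 0

lemma blockPart_monomial (r i n : ℕ) (c : L) :
    blockPart r i (monomial n c) = if n % r = i then monomial (r * (n / r)) c else 0 := by
  rw [blockPart, lsum_apply, sum_monomial_index]
  · split_ifs <;> simp
  · simp

lemma blockPart_mem_degreeLT (r i N : ℕ) {p : L[X]} (hp : p ∈ degreeLT L N) :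
    blockPart r i p ∈ degreeLT L N := by
  rw [p.as_sum_support, map_sum]
  refine Submodule.sum_mem _ fun n hn => ?_
  rw [blockPart_monomial]
  split_ifs
  · rw [mem_degreeLT] at hp ⊢
    refine (degree_monomial_le _ _).trans_lt ?_
    refine lt_of_le_of_lt ?_ ((le_degree_of_mem_supp n hn).trans_lt hp)
    exact_mod_cast Nat.mul_div_le n r
  · exact zero_mem _

lemma X_pow_sub_C_pow_dvd_sub_sum_blockPart {r : ℕ} (hr : 0 < r) (z : L) (p : L[X]) :
    (X ^ r - C z ^ r) ∣ p - ∑ i ∈ range r, X ^ i * C ((blockPart r i p).eval z) := by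
  induction p using Polynomial.induction_on' with
  | add p q hp hq =>
    convert dvd_add hp hq using 1
    simp only [map_add, eval_add, mul_add, sum_add_distrib]
    ring
  | monomial n c =>
    rw [Finset.sum_eq_single (n % r)]
    · rw [blockPart_monomial, if_pos rfl, eval_monomial, ← C_mul_X_pow_eq_monomial]
      have : C c * X ^ n - X ^ (n % r) * C (c * z ^ (r * (n / r)))
          = C c * X ^ (n % r) * ((X ^ r) ^ (n / r) - (C z ^ r) ^ (n / r)) := by
        nth_rw 1 [← Nat.mod_add_div n r]
        simp only [pow_add, pow_mul, map_mul, map_pow]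
        ring
      rw [this]
      exact Dvd.dvd.mul_left (sub_dvd_pow_sub_pow _ _ _) _
    · intro i _ hi
      rw [blockPart_monomial, if_neg (Ne.symm hi)]
      simp
    · intro h
      exact absurd (mem_range.2 (Nat.mod_lt _ hr)) h

lemma eq_zero_of_sq_mul_eq_C_mul_sq {f : L[X]} (hf : Squarefree f) (hdeg : 0 < f.natDegree)
    {c : L} (hc : c ≠ 0) (a b : L[X]) (h : a ^ 2 * f = C c * b ^ 2) : a = 0 := by
  have key : ∀ n : ℕ, ∀ a b : L[X], a.natDegree ≤ n → a ^ 2 * f = C c * b ^ 2 → a = 0 := by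
    intro n
    induction n using Nat.strong_induction_on with
    | _ n ih =>
      intro a b hn hab
      have hf0 : f ≠ 0 := hf.ne_zero
      have hu : IsUnit (C c) := isUnit_C.2 hc.isUnit
      have hb : f ∣ b := by
        have : f ∣ C c * b ^ 2 := ⟨a ^ 2, by rw [← hab, mul_comm]⟩
        rw [hu.dvd_mul_left] at this
        exact hf.isRadical _ _ this
      obtain ⟨t, rfl⟩ := hb
      have h1 : a ^ 2 = C c * f * t ^ 2 := by
        apply mul_right_cancel₀ hf0
        rw [hab]; ring
      have ha : f ∣ a := hf.isRadical 2 _ ⟨C c * t ^ 2, by rw [h1]; ring⟩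
      obtain ⟨u, rfl⟩ := ha
      have h2 : u ^ 2 * f = C c * t ^ 2 := by
        apply mul_left_cancel₀ hf0
        linear_combination h1
      by_contra hne
      have hu0 : u ≠ 0 := right_ne_zero_of_mul hne
      rw [natDegree_mul hf0 hu0] at hn
      exact hu0 (ih u.natDegree (by omega) u t le_rfl h2)
  exact key _ a b le_rfl h

lemma eq_zero_of_X_pow_card_dvd [Fintype L] {f : L[X]} (hf : Squarefree f)
    (hdeg : 0 < f.natDegree) (hf0 : f.coeff 0 ≠ 0) {M D n : ℕ} (hD : f.natDegree ≤ D)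
    (hn : Fintype.card L = 2 * n + 1) (hM : 2 * M + D ≤ 2 * n + 1)
    {a b : L[X]} (ha : a ∈ degreeLT L M) (hb : b ∈ degreeLT L M)
    (h : X ^ (2 * n + 1) ∣ a + b * f ^ n) : a = 0 ∧ b = 0 := by
  have h1 : X ^ (2 * n + 1) ∣ a ^ 2 * f - b ^ 2 * f ^ (2 * n + 1) := by
    have : a ^ 2 * f - b ^ 2 * f ^ (2 * n + 1) = (a + b * f ^ n) * ((a - b * f ^ n) * f) := by
      ring
    rw [this]
    exact h.mul_right _
  have h2 : X ^ (2 * n + 1) ∣ f ^ (2 * n + 1) - C (f.coeff 0) := by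
    rw [← hn, ← FiniteField.expand_card f, X_pow_dvd_iff]
    intro d hd
    rw [coeff_sub, coeff_expand Fintype.card_pos, coeff_C]
    rcases Nat.eq_zero_or_pos d with rfl | hd0
    · simp
    · rw [if_neg (fun hh => absurd (Nat.le_of_dvd hd0 hh) (by omega)), if_neg hd0.ne', sub_zero]
  have h3 : X ^ (2 * n + 1) ∣ a ^ 2 * f - C (f.coeff 0) * b ^ 2 := by
    convert dvd_add h1 (h2.mul_left (b ^ 2)) using 1
    ring
  have h4 : a ^ 2 * f - C (f.coeff 0) * b ^ 2 = 0 := by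
    rcases Nat.eq_zero_or_pos M with rfl | hM0
    · simp only [mem_degreeLT, Nat.cast_zero, Nat.WithBot.lt_zero_iff, degree_eq_bot] at ha hb
      simp [ha, hb]
    have ha' : a.natDegree < M := by
      by_cases h : a = 0
      · simpa [h] using hM0
      · rwa [natDegree_lt_iff_degree_lt h, ← mem_degreeLT]
    have hb' : b.natDegree < M := by
      by_cases h : b = 0
      · simpa [h] using hM0
      · rwa [natDegree_lt_iff_degree_lt h, ← mem_degreeLT]
    refine eq_zero_of_dvd_of_natDegree_lt h3 ?_
    rw [natDegree_X_pow]
    refine (natDegree_sub_le _ _).trans_lt (max_lt ?_ ?_)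
    · have := natDegree_mul_le (p := a ^ 2) (q := f)
      have := natDegree_pow_le (p := a) (n := 2)
      omega
    · have := natDegree_C_mul_le (f.coeff 0) (b ^ 2)
      have := natDegree_pow_le (p := b) (n := 2)
      omega
  have ha0 := eq_zero_of_sq_mul_eq_C_mul_sq hf hdeg hf0 a b (sub_eq_zero.1 h4)
  refine ⟨ha0, ?_⟩
  simpa [ha0, hf0] using h4

lemma eq_zero_of_sum_mul_X_pow_eq_zero [Fintype L] {f : L[X]} (hf : Squarefree f)
    (hdeg : 0 < f.natDegree) (hf0 : f.coeff 0 ≠ 0) {M D n : ℕ} (hD : f.natDegree ≤ D)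
    (hn : Fintype.card L = 2 * n + 1) (hM : 2 * M + D ≤ 2 * n + 1) (J : ℕ)
    (a b : Fin J → L[X]) (ha : ∀ j, a j ∈ degreeLT L M) (hb : ∀ j, b j ∈ degreeLT L M)
    (h : ∑ j, (a j + b j * f ^ n) * X ^ ((2 * n + 1) * (j : ℕ)) = 0) (j : Fin J) :
    a j = 0 ∧ b j = 0 := by
  induction J with
  | zero => exact j.elim0
  | succ J ih =>
    have hX : (X ^ (2 * n + 1) : L[X]) ≠ 0 := pow_ne_zero _ X_ne_zero
    have hsum : (∑ j : Fin J, (a j.succ + b j.succ * f ^ n) * X ^ ((2 * n + 1) * (j.succ : ℕ)))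
        = X ^ (2 * n + 1) *
          ∑ j : Fin J, (a j.succ + b j.succ * f ^ n) * X ^ ((2 * n + 1) * (j : ℕ)) := by
      rw [mul_sum]
      refine sum_congr rfl fun j _ => ?_
      rw [Fin.val_succ, mul_add, pow_add]
      ring
    rw [Fin.sum_univ_succ, hsum] at h
    simp only [Fin.val_zero, mul_zero, pow_zero, mul_one] at h
    have h0 : a 0 = 0 ∧ b 0 = 0 :=
      eq_zero_of_X_pow_card_dvd hf hdeg hf0 hD hn hM (ha 0) (hb 0)
        ((dvd_add_left (dvd_mul_right _ _)).1 (h ▸ dvd_zero _))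
    rw [h0.1, h0.2, zero_mul, zero_add, zero_add] at h
    have := ih (fun j => a j.succ) (fun j => b j.succ) (fun j => ha _) (fun j => hb _)
      ((mul_eq_zero.1 h).resolve_left hX)
    exact Fin.cases h0 this j

/-- Stepanov's auxiliary polynomial. -/
lemma exists_stepanov_polynomial [Fintype L] {h : ℕ} {f : L[X]} (hf : Squarefree f)
    (hdeg : 0 < f.natDegree) (hf0 : f.coeff 0 ≠ 0) {M D J : ℕ} (hD : f.natDegree ≤ D)
    (hcard : Fintype.card L = (2 * h + 1) ^ 2)
    (hM : 2 * M + D ≤ (2 * h + 1) ^ 2)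
    (hJ : (2 * h + 1) * (M + D * h + J) < J * (2 * M)) :
    ∃ a b : Fin J → L[X], (∀ j, a j ∈ degreeLT L M) ∧ (∀ j, b j ∈ degreeLT L M) ∧
      (∑ j, (a j + b j * f ^ (2 * h * (h + 1))) * X ^ ((2 * h + 1) ^ 2 * (j : ℕ)) ≠ 0) ∧
      ∀ i < 2 * h + 1, ∑ j, (f ^ h * blockPart (2 * h + 1) i (a j)
        - blockPart (2 * h + 1) i (f ^ h * b j)) * X ^ (j : ℕ) = 0 := by
  have hN : ∀ (p : L[X]), p ∈ degreeLT L M → f ^ h * p ∈ degreeLT L (M + D * h) := by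
    intro p hp
    rw [mem_degreeLT] at hp ⊢
    by_cases hp0 : p = 0
    · simp only [hp0, mul_zero, degree_zero]; exact WithBot.bot_lt_coe _
    · have h1 := (natDegree_lt_iff_degree_lt hp0).2 hp
      refine lt_of_le_of_lt degree_le_natDegree ?_
      have h2 := natDegree_mul_le (p := f ^ h) (q := p)
      have h3 := natDegree_pow_le (p := f) (n := h)
      have h4 : h * f.natDegree ≤ D * h := by rw [mul_comm]; exact Nat.mul_le_mul_right _ hD
      exact_mod_cast (by omega : (f ^ h * p).natDegree < M + D * h)
  have hX : ∀ (p : L[X]) (j : Fin J), p ∈ degreeLT L (M + D * h) →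
      p * X ^ (j : ℕ) ∈ degreeLT L (M + D * h + J) := by
    intro p j hp
    rw [mem_degreeLT] at hp ⊢
    by_cases hp0 : p = 0
    · simp only [hp0, zero_mul, degree_zero]; exact WithBot.bot_lt_coe _
    · have h1 := (natDegree_lt_iff_degree_lt hp0).2 hp
      refine lt_of_le_of_lt degree_le_natDegree ?_
      have h2 := natDegree_mul_le (p := p) (q := X ^ (j : ℕ))
      rw [natDegree_X_pow] at h2
      have := j.2
      exact_mod_cast (by omega : (p * X ^ (j : ℕ)).natDegree < M + D * h + J)
  let V := Fin J → (degreeLT L M × degreeLT L M)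
  let A : Fin J → V →ₗ[L] L[X] := fun j =>
    (degreeLT L M).subtype ∘ₗ LinearMap.fst L _ _ ∘ₗ LinearMap.proj j
  let B : Fin J → V →ₗ[L] L[X] := fun j =>
    (degreeLT L M).subtype ∘ₗ LinearMap.snd L _ _ ∘ₗ LinearMap.proj j
  let Φ₀ : Fin (2 * h + 1) → V →ₗ[L] L[X] := fun i => ∑ j : Fin J,
    LinearMap.mulRight L (X ^ (j : ℕ)) ∘ₗ
      (LinearMap.mulLeft L (f ^ h) ∘ₗ blockPart (2 * h + 1) i ∘ₗ A j
        - blockPart (2 * h + 1) i ∘ₗ LinearMap.mulLeft L (f ^ h) ∘ₗ B j)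
  have hΦ₀ : ∀ i v, Φ₀ i v = ∑ j, (f ^ h * blockPart (2 * h + 1) i ((v j).1 : L[X])
        - blockPart (2 * h + 1) i (f ^ h * ((v j).2 : L[X]))) * X ^ (j : ℕ) := by
    intro i v
    simp [Φ₀, A, B]
    rfl
  have hmem : ∀ i v, Φ₀ i v ∈ degreeLT L (M + D * h + J) := by
    intro i v
    rw [hΦ₀]
    refine Submodule.sum_mem _ fun j _ => hX _ _ (Submodule.sub_mem _ ?_ ?_)
    · exact hN _ (blockPart_mem_degreeLT _ _ _ (v j).1.2)
    · exact blockPart_mem_degreeLT _ _ _ (hN _ (v j).2.2)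
  let Φ : V →ₗ[L] (Fin (2 * h + 1) → degreeLT L (M + D * h + J)) :=
    LinearMap.pi fun i => (Φ₀ i).codRestrict _ (hmem i)
  have hfin : ∀ n, Module.finrank L (degreeLT L n) = n := fun n => by
    rw [(degreeLTEquiv L n).finrank_eq, Module.finrank_fin_fun]
  have hfi : ∀ n, Module.Finite L (degreeLT L n) := fun n =>
    Module.Finite.equiv (degreeLTEquiv L n).symm
  have hker : LinearMap.ker Φ ≠ ⊥ := by
    apply LinearMap.ker_ne_bot_of_finrank_lt
    rw [Module.finrank_pi_fintype, Module.finrank_pi_fintype]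
    simp only [Module.finrank_prod, hfin, sum_const, card_univ, Fintype.card_fin, smul_eq_mul]
    rwa [← two_mul]
  obtain ⟨v, hv, hv0⟩ := (Submodule.ne_bot_iff _).1 hker
  refine ⟨fun j => (v j).1, fun j => (v j).2, fun j => (v j).1.2, fun j => (v j).2.2, ?_, ?_⟩
  · intro hP
    have e : (2 * h + 1) ^ 2 = 2 * (2 * h * (h + 1)) + 1 := by ring
    rw [e] at hP hcard hM
    have := eq_zero_of_sum_mul_X_pow_eq_zero hf hdeg hf0 hD hcard hM J
      (fun j => (v j).1) (fun j => (v j).2) (fun j => (v j).1.2) (fun j => (v j).2.2) hP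
    refine hv0 (funext fun j => Prod.ext (Subtype.ext (this j).1) (Subtype.ext (this j).2))
  · intro i hi
    rw [LinearMap.mem_ker] at hv
    have := congrArg (fun w => ((w ⟨i, hi⟩ : degreeLT L (M + D * h + J)) : L[X])) hv
    simpa [Φ, hΦ₀] using this

/-- Stepanov's method: the number of nonsquare values of a squarefree polynomial over a
finite field with `r ^ 2` elements, where `r = 2 * h + 1`. -/
theorem card_pow_eq_neg_one_mul_le [Fintype L] {h p e : ℕ} [ExpChar L p] {f : L[X]}
    (hf : Squarefree f)
    (hdeg : 0 < f.natDegree) (hf0 : f.coeff 0 ≠ 0) {M D J : ℕ} (hD : f.natDegree ≤ D)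
    (hr : 2 * h + 1 = p ^ e)
    (hcard : Fintype.card L = (2 * h + 1) ^ 2)
    (hM : 2 * M + D ≤ (2 * h + 1) ^ 2)
    (hJ : (2 * h + 1) * (M + D * h + J) < J * (2 * M)) :
    #{z : L | f.eval z ^ (2 * h * (h + 1)) = -1} * (2 * h + 1)
      ≤ M + D * (2 * h * (h + 1)) + J * (2 * h + 1) ^ 2 := by
  obtain ⟨a, b, ha, hb, hP, hab⟩ := exists_stepanov_polynomial hf hdeg hf0 hD hcard hM hJ
  set r := 2 * h + 1 with hrdef
  set P := ∑ j, (a j + b j * f ^ (2 * h * (h + 1))) * X ^ (r ^ 2 * (j : ℕ)) with hPdef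
  have hfrob : ∀ s t : L[X], (s - t) ^ r = s ^ r - t ^ r := by
    intro s t
    rw [hr, sub_pow_expChar_pow]
  have hdvd : ∀ z : L, f.eval z ^ (2 * h * (h + 1)) = -1 → (X - C z) ^ r ∣ P := by
    intro z hz
    set u := f.eval z with hu
    have hu0 : u ≠ 0 := by
      rintro h0
      rcases Nat.eq_zero_or_pos (2 * h * (h + 1)) with hn | hn
      · have : h = 0 := by
          rcases mul_eq_zero.1 hn with h' | h' <;> omega
        subst this
        norm_num [hrdef] at hcard
        exact absurd hcard (Fintype.one_lt_card).ne'
      · rw [h0, zero_pow hn.ne'] at hz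
        exact one_ne_zero (neg_eq_zero.1 hz.symm)
    have hzr : z ^ (r ^ 2) = z := by rw [← hcard, FiniteField.pow_card]
    set W := ∑ j, (C (u ^ h) * a j - f ^ h * b j) * C (z ^ (j : ℕ)) with hW
    have hmod : (X - C z) ^ r ∣ (X ^ r - C z ^ r) := by rw [hfrob]
    have h1 : (X - C z) ^ r ∣ f ^ (h * r) - C (u ^ (h * r)) := by
      rw [pow_mul, pow_mul u, map_pow, ← hfrob]
      refine pow_dvd_pow_of_dvd ?_ _
      rw [map_pow]
      refine (?_ : X - C z ∣ f - C u).trans (sub_dvd_pow_sub_pow _ _ _)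
      rw [dvd_iff_isRoot]; simp [hu]
    have h2 : ∀ j : ℕ, (X - C z) ^ r ∣ X ^ (r ^ 2 * j) - C (z ^ j) := by
      intro j
      refine hmod.trans ?_
      have := sub_dvd_pow_sub_pow (X ^ r) (C z ^ r) (r * j)
      rw [← pow_mul, ← pow_mul, ← mul_assoc, ← sq] at this
      rw [← show z ^ (r ^ 2 * j) = z ^ j by rw [pow_mul, hzr], map_pow C]
      exact this
    have h3 : (X - C z) ^ r ∣ C (u ^ h) * P - W := by
      rw [hPdef, hW, mul_sum, ← sum_sub_distrib]
      refine dvd_sum fun j _ => ?_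
      have e1 : (C (u ^ h) * C (u ^ (h * r)) : L[X]) = -1 := by
        rw [← map_mul, ← pow_add, show h + h * r = 2 * h * (h + 1) by rw [hrdef]; ring, hz]
        simp
      have e2 : C (u ^ h) * ((a j + b j * f ^ (2 * h * (h + 1))) * X ^ (r ^ 2 * (j : ℕ)))
          - (C (u ^ h) * a j - f ^ h * b j) * C (z ^ (j : ℕ))
          = C (u ^ h) * (a j + b j * f ^ (2 * h * (h + 1))) *
              (X ^ (r ^ 2 * (j : ℕ)) - C (z ^ (j : ℕ)))
            + C (u ^ h) * b j * f ^ h * C (z ^ (j : ℕ)) * (f ^ (h * r) - C (u ^ (h * r))) := by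
        rw [show 2 * h * (h + 1) = h + h * r by rw [hrdef]; ring, pow_add]
        linear_combination (b j * f ^ h * C (z ^ (j : ℕ))) * e1
      rw [e2]
      exact dvd_add ((h2 j).mul_left _) (h1.mul_left _)
    have h4 : (X - C z) ^ r ∣ W := by
      have := X_pow_sub_C_pow_dvd_sub_sum_blockPart (r := r) (by omega) z W
      rw [sum_eq_zero, sub_zero] at this
      · exact hmod.trans this
      intro i hi
      have hi' := congrArg (eval z) (hab i (mem_range.1 hi))
      have : (blockPart r i W).eval z = 0 := by
        rw [← eval_zero (x := z), ← hi', hW, map_sum, eval_finsetSum, eval_finsetSum]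
        refine sum_congr rfl fun j _ => ?_
        rw [mul_comm _ (C (z ^ (j : ℕ))), mul_sub, mul_comm (C (z ^ (j : ℕ))),
          mul_comm (C (z ^ (j : ℕ))), mul_comm _ (C (z ^ (j : ℕ))), ← smul_eq_C_mul,
          mul_comm _ (C (z ^ (j : ℕ))), ← smul_eq_C_mul, ← smul_eq_C_mul, ← smul_sub,
          map_smul, map_sub, map_smul]
        simp [hu]
        ring
      rw [this]; simp
    have h5 : (X - C z) ^ r ∣ C (u ^ h) * P := by
      have := dvd_add h3 h4
      rwa [sub_add_cancel] at this
    rwa [(isUnit_C.2 (pow_ne_zero _ hu0).isUnit).dvd_mul_left] at h5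
  have hprod : ∏ z ∈ ({z : L | f.eval z ^ (2 * h * (h + 1)) = -1} : Finset L), (X - C z) ^ r
      ∣ P := by
    refine Finset.prod_dvd_of_coprime ?_ ?_
    · intro x _ y _ hxy
      exact (isCoprime_X_sub_C_of_isUnit_sub (sub_ne_zero.2 hxy).isUnit).pow
    · intro z hz
      exact hdvd z (mem_filter.1 hz).2
  have hle := natDegree_le_of_dvd hprod hP
  rw [natDegree_prod_of_monic _ _ (fun z _ => (monic_X_sub_C z).pow r)] at hle
  simp only [natDegree_pow, natDegree_X_sub_C, mul_one, sum_const, smul_eq_mul] at hle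
  refine hle.trans ?_
  rw [hPdef]
  refine natDegree_sum_le_of_forall_le _ _ fun j _ => ?_
  have hM' : ∀ q : L[X], q ∈ degreeLT L M → q.natDegree ≤ M := fun q hq =>
    natDegree_le_of_degree_le (mem_degreeLT.1 hq).le
  refine natDegree_mul_le.trans ?_
  rw [natDegree_X_pow]
  refine add_le_add ((natDegree_add_le _ _).trans (max_le ?_ ?_)) ?_
  · exact (hM' _ (ha j)).trans (Nat.le_add_right _ _)
  · refine natDegree_mul_le.trans (add_le_add (hM' _ (hb j)) ?_)
    refine natDegree_pow_le.trans ?_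
    rw [mul_comm]
    exact Nat.mul_le_mul_right _ hD
  · rw [mul_comm]; exact Nat.mul_le_mul_right _ j.2.le

end Stepanov

section Kloosterman

variable {F : Type*} [Field F] [Fintype F]

/-- The Kloosterman sum of an additive character. -/
noncomputable def kloosterman (ψ : AddChar F ℂ) (a b : F) : ℂ :=
  ∑ x : F with x ≠ 0, ψ (a * x + b * x⁻¹)

lemma star_kloosterman (ψ : AddChar F ℂ) (a b : F) :
    (starRingEnd ℂ) (kloosterman ψ a b) = kloosterman ψ a b := by
  rw [kloosterman, map_sum]
  refine sum_bij' (fun x _ => -x) (fun x _ => -x) ?_ ?_ ?_ ?_ ?_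
  · intro x; simp
  · intro x; simp
  · intro x; simp
  · intro x; simp
  · intro x _
    rw [← AddChar.map_neg_eq_conj]
    congr 1
    rw [inv_neg]; ring

lemma ofReal_re_kloosterman (ψ : AddChar F ℂ) (a b : F) :
    ((kloosterman ψ a b).re : ℂ) = kloosterman ψ a b :=
  Complex.conj_eq_iff_re.1 (star_kloosterman ψ a b)

lemma card_sq_add_card_mul_sq (h2 : ringChar F ≠ 2) {δ : F} (hδ : ¬ IsSquare δ) (e : F) :
    #{v : F | v ^ 2 = e} + #{v : F | δ * v ^ 2 = e} = 2 := by
  have hδ0 : δ ≠ 0 := by rintro rfl; exact hδ (IsSquare.zero)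
  have h := fun a => quadraticChar_card_sqrts h2 a
  have key : ∀ a : F, (#{v : F | v ^ 2 = a} : ℤ) = quadraticChar F a + 1 := by
    intro a
    rw [← h a]
    congr 2
    ext; simp
  have e1 : #{v : F | δ * v ^ 2 = e} = #{v : F | v ^ 2 = δ⁻¹ * e} := by
    congr 1; ext v
    simp only [mem_filter, mem_univ, true_and]
    rw [eq_inv_mul_iff_mul_eq₀ hδ0]
  zify
  rw [e1, key, key, map_mul]
  have : quadraticChar F δ⁻¹ = -1 := by
    rw [quadraticChar_neg_one_iff_not_isSquare, isSquare_inv]; exact hδ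
  rw [this]; ring

/-- A sum over `u, v` of a function of `u` and `u ^ 2 - ε * v ^ 2`, for `ε = 1` and for a
nonsquare `ε`. -/
lemma sum_sq_sub_sq_add_sum_sq_sub_mul_sq (h2 : ringChar F ≠ 2) {δ : F} (hδ : ¬ IsSquare δ)
    (H : F → F → ℂ) :
    ∑ u, ∑ v, H u (u ^ 2 - v ^ 2) + ∑ u, ∑ v, H u (u ^ 2 - δ * v ^ 2) = 2 * ∑ u, ∑ p, H u p := by
  have key : ∀ (ε u : F), ∑ v, H u (u ^ 2 - ε * v ^ 2)
      = ∑ p, (#{v : F | ε * v ^ 2 = u ^ 2 - p} : ℂ) * H u p := by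
    intro ε u
    rw [← Finset.sum_fiberwise univ (fun v => u ^ 2 - ε * v ^ 2)]
    refine sum_congr rfl fun p _ => ?_
    rw [← nsmul_eq_mul, ← sum_const]
    refine sum_congr ?_ ?_
    · ext v
      simp only [mem_filter, mem_univ, true_and]
      constructor <;> intro h <;> linear_combination -h
    · intro v hv
      have : u ^ 2 - ε * v ^ 2 = p := by
        have := (mem_filter.1 hv).2
        linear_combination -this
      rw [this]
  have key1 := fun u => key 1 u
  simp only [one_mul] at key1
  rw [mul_sum, ← sum_add_distrib]
  refine sum_congr rfl fun u _ => ?_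
  rw [key1, key, ← sum_add_distrib, mul_sum]
  refine sum_congr rfl fun p _ => ?_
  rw [← add_mul]
  congr 1
  exact_mod_cast card_sq_add_card_mul_sq h2 hδ (u ^ 2 - p)

lemma kloosterman_sq_eq (h2 : ringChar F ≠ 2) (ψ : AddChar F ℂ) (a b : F) :
    kloosterman ψ a b ^ 2 = ∑ u, ∑ v, (if u ^ 2 - v ^ 2 = 0 then 0 else
      ψ (2 * (a * u + b * (u * (u ^ 2 - v ^ 2)⁻¹)))) := by
  have h20 : (2 : F) ≠ 0 := Ring.two_ne_zero h2
  rw [kloosterman, sq, sum_filter, sum_mul_sum, ← sum_product', ← sum_product']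
  refine sum_bij' (fun x _ => ((x.1 + x.2) / 2, (x.1 - x.2) / 2))
    (fun x _ => (x.1 + x.2, x.1 - x.2)) ?_ ?_ ?_ ?_ ?_
  · simp
  · simp
  · rintro ⟨x, y⟩ _
    ext
    · simp only; field_simp; ring
    · simp only; field_simp; ring
  · rintro ⟨x, y⟩ _
    ext
    · simp only; field_simp; ring
    · simp only; field_simp; ring
  · rintro ⟨x, y⟩ _
    simp only
    have e : ((x + y) / 2) ^ 2 - ((x - y) / 2) ^ 2 = x * y := by field_simp; ring
    rw [e]
    by_cases hx : x = 0
    · simp [hx]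
    by_cases hy : y = 0
    · simp [hy]
    rw [if_pos hx, if_pos hy, if_neg (mul_ne_zero hx hy), ← AddChar.map_add_eq_mul]
    congr 1
    field_simp
    ring

lemma sum_sum_addChar (h2 : ringChar F ≠ 2) {ψ : AddChar F ℂ} (hψ : ψ ≠ 1) {a b : F}
    (ha : a ≠ 0) (hb : b ≠ 0) :
    ∑ u, ∑ p, (if p = 0 then 0 else ψ (2 * (a * u + b * (u * p⁻¹)))) = (Fintype.card F : ℂ) := by
  have h20 : (2 : F) ≠ 0 := Ring.two_ne_zero h2
  rw [sum_comm, sum_eq_single (-b / a)]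
  · have : -b / a ≠ 0 := div_ne_zero (neg_ne_zero.2 hb) ha
    simp only [if_neg this]
    rw [sum_congr rfl (g := fun _ => (1 : ℂ)), sum_const, card_univ, nsmul_eq_mul, mul_one]
    intro u _
    rw [← AddChar.map_zero_eq_one ψ]
    congr 1
    field_simp
    ring
  · intro p _ hp
    by_cases hp0 : p = 0
    · simp [hp0]
    simp only [if_neg hp0]
    have := AddChar.sum_mulShift (2 * (a + b * p⁻¹)) (AddChar.IsPrimitive.of_ne_one hψ)
    rw [if_neg] at this
    · rw [Nat.cast_zero] at this
      rw [← this]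
      refine sum_congr rfl fun u _ => ?_
      congr 1; ring
    · intro h
      have h' := (mul_eq_zero.1 h).resolve_left h20
      apply hp
      field_simp at h' ⊢
      linear_combination h'
  · simp

instance quadraticAlgebraFintype {R : Type*} [Fintype R] (a b : R) :
    Fintype (QuadraticAlgebra R a b) :=
  Fintype.ofEquiv _ (QuadraticAlgebra.equivProd a b).symm

lemma card_quadraticAlgebra {R : Type*} [Fintype R] (a b : R) :
    Fintype.card (QuadraticAlgebra R a b) = Fintype.card R ^ 2 := by
  rw [Fintype.card_congr (QuadraticAlgebra.equivProd a b), Fintype.card_prod, sq]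

/-- The additive map `z ↦ z.re + z.re`, which is the trace of `F(√δ)` over `F`. -/
def doubleRe (δ : F) : QuadraticAlgebra F δ 0 →+ F where
  toFun z := z.re + z.re
  map_zero' := by simp
  map_add' x y := by simp; ring

/-- The quadratic case of the Hasse-Davenport relation for Kloosterman sums. -/
lemma kloosterman_quadraticAlgebra (h2 : ringChar F ≠ 2) {ψ : AddChar F ℂ} (hψ : ψ ≠ 1) {a b : F}
    (ha : a ≠ 0) (hb : b ≠ 0) {δ : F} (hδ : ¬ IsSquare δ) [Fact (∀ r : F, r ^ 2 ≠ δ + 0 * r)] :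
    kloosterman (ψ.compAddMonoidHom (doubleRe δ)) (QuadraticAlgebra.C a) (QuadraticAlgebra.C b)
      = 2 * Fintype.card F - kloosterman ψ a b ^ 2 := by
  have h := sum_sq_sub_sq_add_sum_sq_sub_mul_sq h2 hδ
    (fun u p => if p = 0 then 0 else ψ (2 * (a * u + b * (u * p⁻¹))))
  rw [sum_sum_addChar h2 hψ ha hb, ← kloosterman_sq_eq h2] at h
  rw [← h, add_sub_cancel_left, kloosterman, sum_filter, ← sum_product']
  refine sum_equiv (QuadraticAlgebra.equivProd δ 0) (by simp) fun z _ => ?_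
  have hn : z.norm = z.re ^ 2 - δ * z.im ^ 2 := by
    rw [QuadraticAlgebra.norm_def]; ring
  have hz : z = 0 ↔ z.re ^ 2 - δ * z.im ^ 2 = 0 := by
    rw [← hn, QuadraticAlgebra.norm_eq_zero_iff_eq_zero]
  have e1 : (QuadraticAlgebra.equivProd δ 0 z).1 = z.re := rfl
  have e2 : (QuadraticAlgebra.equivProd δ 0 z).2 = z.im := rfl
  rw [e1, e2]
  by_cases h0 : z = 0
  · rw [if_neg (not_not.2 h0), if_pos (hz.1 h0)]
  rw [if_pos h0, if_neg (fun h => h0 (hz.2 h)), AddChar.compAddMonoidHom_apply]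
  congr 1
  have : (z⁻¹).re = z.re * (z.re ^ 2 - δ * z.im ^ 2)⁻¹ := by
    rw [QuadraticAlgebra.re_inv, ← hn]
    simp [mul_comm]
  simp [doubleRe, this]
  ring

lemma exists_prime_charP_eq_pow {q n : ℕ} (hn : n ≠ 0) (hF : Fintype.card F = q ^ n) :
    ∃ p e : ℕ, p.Prime ∧ CharP F p ∧ q = p ^ e := by
  obtain ⟨p, hp⟩ := CharP.exists F
  obtain ⟨m, hpp, hm⟩ := FiniteField.card F p
  refine ⟨p, ?_⟩
  have : q ∣ p ^ (m : ℕ) := by rw [← hm, hF]; exact dvd_pow_self q hn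
  obtain ⟨e, _, he⟩ := (Nat.dvd_prime_pow hpp).1 this
  exact ⟨e, hpp, hp, he⟩

lemma ringChar_ne_two_of_card_eq_pow {q n : ℕ} (hodd : Odd q) (hF : Fintype.card F = q ^ n) :
    ringChar F ≠ 2 := by
  intro h
  have := FiniteField.even_card_of_char_two h
  have h' : Odd (Fintype.card F) := hF ▸ hodd.pow
  rw [Nat.odd_iff] at h'
  omega

lemma doubleRe_pow {q n : ℕ} (hodd : Odd q) (hn : n ≠ 0) (hF : Fintype.card F = q ^ n) (δ : F)
    (z : QuadraticAlgebra F δ 0) : doubleRe δ (z ^ q) = doubleRe δ z ^ q := by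
  obtain ⟨p, e, hpp, hp, he⟩ := exists_prime_charP_eq_pow hn hF
  have : CharP (QuadraticAlgebra F δ 0) p :=
    charP_of_injective_algebraMap (QuadraticAlgebra.algebraMap_injective) p
  have : Fact p.Prime := ⟨hpp⟩
  have hz : z = QuadraticAlgebra.C z.re + QuadraticAlgebra.C z.im * QuadraticAlgebra.omega := by
    ext <;> simp
  obtain ⟨m, hm⟩ := hodd
  have hω : (QuadraticAlgebra.omega : QuadraticAlgebra F δ 0) ^ q
      = QuadraticAlgebra.C (δ ^ m) * QuadraticAlgebra.omega := by
    rw [hm, pow_succ, pow_mul, sq, QuadraticAlgebra.omega_mul_omega_eq_mk, QuadraticAlgebra.C_pow]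
    rfl
  have hre : (z ^ q).re = z.re ^ q := by
    have : z ^ q = QuadraticAlgebra.C (z.re ^ q)
        + QuadraticAlgebra.C (z.im ^ q) * (QuadraticAlgebra.C (δ ^ m) * QuadraticAlgebra.omega) := by
      conv_lhs => rw [hz]
      rw [he, add_pow_char_pow, ← he, mul_pow, hω, QuadraticAlgebra.C_pow, QuadraticAlgebra.C_pow,
        QuadraticAlgebra.C_pow]
    rw [this]
    simp only [QuadraticAlgebra.re_add, QuadraticAlgebra.re_mul, QuadraticAlgebra.im_mul,
      QuadraticAlgebra.re_C, QuadraticAlgebra.im_C, QuadraticAlgebra.omega_re]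
    ring
  change (z ^ q).re + (z ^ q).re = (z.re + z.re) ^ q
  rw [hre, he, add_pow_char_pow]

end Kloosterman

section Tower

variable {k : Type} [Field k] [Fintype k]

/-- The Kloosterman sums over the fields of the tower of quadratic extensions of a field with
`q` elements. -/
def kloostermanTower (q : ℕ) (K : ℝ) : ℕ → ℝ
  | 0 => K
  | i + 1 => 2 * (q : ℝ) ^ 2 ^ i - kloostermanTower q K i ^ 2

lemma exists_field_kloosterman_eq {q : ℕ} (hodd : Odd q) (hk : Fintype.card k = q)
    {ψ : AddChar k ℂ} (hψ : ψ ≠ 1) {a b : k} (ha : a ≠ 0) (hb : b ≠ 0) (i : ℕ) :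
    ∃ (L : Type) (_ : Field L) (_ : Fintype L) (τ : L →+ k) (α β : L),
      Fintype.card L = q ^ 2 ^ i ∧ Function.Surjective τ ∧ (∀ z, τ (z ^ q) = τ z) ∧
      α ≠ 0 ∧ β ≠ 0 ∧ ∀ s, s ≠ 0 →
        kloosterman ((ψ.mulShift s).compAddMonoidHom τ) α β
          = kloostermanTower q (kloosterman (ψ.mulShift s) a b).re i := by
  induction i with
  | zero =>
    refine ⟨k, inferInstance, inferInstance, AddMonoidHom.id k, a, b, by simp [hk],
      Function.surjective_id, ?_, ha, hb, fun s _ => ?_⟩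
    · intro z
      rw [← hk, FiniteField.pow_card]
    · exact (ofReal_re_kloosterman (ψ.mulShift s) a b).symm
  | succ i ih =>
    obtain ⟨L, _, _, τ, α, β, hL, hτ, hτq, hα, hβ, h⟩ := ih
    have h2 := ringChar_ne_two_of_card_eq_pow hodd hL
    obtain ⟨δ, hδ⟩ := FiniteField.exists_nonsquare h2
    have : Fact (∀ r : L, r ^ 2 ≠ δ + 0 * r) :=
      ⟨fun r hr => hδ ⟨r, by rw [← sq, hr]; ring⟩⟩
    refine ⟨QuadraticAlgebra L δ 0, inferInstance, inferInstance, τ.comp (doubleRe δ),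
      QuadraticAlgebra.C α, QuadraticAlgebra.C β, ?_, ?_, ?_, ?_, ?_, ?_⟩
    · rw [card_quadraticAlgebra, hL, ← pow_mul, pow_succ]
    · intro c
      obtain ⟨x, rfl⟩ := hτ c
      refine ⟨QuadraticAlgebra.C (x / 2), ?_⟩
      have : NeZero (2 : L) := ⟨Ring.two_ne_zero h2⟩
      change τ (x / 2 + x / 2) = τ x
      rw [add_halves]
    · intro z
      simp only [AddMonoidHom.comp_apply]
      rw [doubleRe_pow hodd (pow_ne_zero _ two_ne_zero) hL, hτq]
    · simpa [QuadraticAlgebra.C_eq_zero_iff] using hα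
    · simpa [QuadraticAlgebra.C_eq_zero_iff] using hβ
    · intro s hs
      have hne : (ψ.mulShift s).compAddMonoidHom τ ≠ 1 := by
        intro h1
        refine (AddChar.IsPrimitive.of_ne_one hψ hs) ?_
        ext c
        obtain ⟨x, rfl⟩ := hτ c
        exact DFunLike.congr_fun h1 x
      have := kloosterman_quadraticAlgebra h2 hne hα hβ hδ
      rw [h s hs, hL] at this
      rw [kloostermanTower]
      push_cast at this ⊢
      exact this

end Tower

section ArtinSchreier

open Polynomial

variable {L : Type*} [Field L] {q : ℕ}

lemma natDegree_X_pow_sub_X_sq_sub_C (hq : 1 < q) (c : L) :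
    ((X ^ q - X) ^ 2 - C c : L[X]).natDegree = 2 * q := by
  rw [natDegree_sub_C, natDegree_pow, FiniteField.X_pow_card_sub_X_natDegree_eq L hq]

lemma squarefree_X_pow_sub_X_sq_sub_C (hq : (q : L) = 0) {c : L} (hc : c ≠ 0)
    (h2 : (2 : L) ≠ 0) : Squarefree ((X ^ q - X) ^ 2 - C c : L[X]) := by
  apply Separable.squarefree
  refine ⟨-C c⁻¹, -C ((2 * c)⁻¹) * (X ^ q - X), ?_⟩
  have h1 : (C c⁻¹ * C c : L[X]) = 1 := by rw [← C_mul, inv_mul_cancel₀ hc, C_1]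
  have h3 : (C ((2 * c)⁻¹) * 2 : L[X]) = C c⁻¹ := by
    rw [show (2 : L[X]) = C 2 from rfl, ← C_mul]
    congr 1; field_simp
  have hder : derivative ((X ^ q - X) ^ 2 - C c : L[X]) = -2 * (X ^ q - X) := by
    rw [derivative_sub, derivative_C, derivative_sq, derivative_sub, derivative_X_pow, hq]
    simp only [map_zero, zero_mul, derivative_X, map_ofNat]
    ring
  rw [hder]
  linear_combination h1 + (X ^ q - X) ^ 2 * h3

variable [Fintype L]

/-- Lower bound for the number of values of `α * x + β / x` of the form `z ^ q - z`. -/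
lemma card_le_card_mul_add_div_eq {h p e : ℕ} [ExpChar L p] (hr : 2 * h + 1 = p ^ e)
    (hcard : Fintype.card L = (2 * h + 1) ^ 2) (hq1 : 1 < q) (hqh : q < h) (hq : (q : L) = 0)
    (h2 : ringChar L ≠ 2) {α β : L} (hα : α ≠ 0) (hβ : β ≠ 0) :
    (2 * h + 1) ^ 2 ≤ #{x : L × L | x.1 ≠ 0 ∧ α * x.1 + β * x.1⁻¹ = x.2 ^ q - x.2}
      + (8 * q + 4) * (2 * h + 1) := by
  have h20 : (2 : L) ≠ 0 := Ring.two_ne_zero h2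
  set c : L := 4 * (α * β) with hc
  have hc0 : c ≠ 0 := by
    rw [hc, show (4 : L) = 2 * 2 by norm_num]
    exact mul_ne_zero (mul_ne_zero h20 h20) (mul_ne_zero hα hβ)
  set f : L[X] := (X ^ q - X) ^ 2 - C c with hf
  have hfev : ∀ z, f.eval z = (z ^ q - z) ^ 2 - c := by intro z; simp [hf]
  have hdeg : f.natDegree = 2 * q := natDegree_X_pow_sub_X_sq_sub_C hq1 c
  have hf0 : f.coeff 0 ≠ 0 := by
    rw [coeff_zero_eq_eval_zero, hfev, zero_pow (by omega)]
    simpa using hc0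
  have hqh2 : q ≤ 2 * h ^ 2 + 2 * h := by nlinarith
  obtain ⟨M, hM⟩ := Nat.exists_eq_add_of_le hqh2
  have hZ := card_pow_eq_neg_one_mul_le (M := M) (D := 2 * q) (J := h + q + 2)
    (squarefree_X_pow_sub_X_sq_sub_C hq hc0 h20) (hdeg ▸ by omega) hf0 hdeg.le hr hcard
    (by nlinarith) (by zify at hM hqh ⊢; have hM' : (M : ℤ) = 2 * h ^ 2 + 2 * h - q := by linarith
                       rw [hM']
                       nlinarith)
  set Z : Finset L := {z : L | f.eval z ^ (2 * h * (h + 1)) = -1} with hZdef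
  set Z₀ : Finset L := {z : L | f.eval z = 0} with hZ₀def
  set W : Finset L := {z : L | f.eval z ≠ 0 ∧ IsSquare (f.eval z)} with hWdef
  set T : Finset (L × L) := {x : L × L | x.1 ≠ 0 ∧ α * x.1 + β * x.1⁻¹ = x.2 ^ q - x.2} with hT
  have hZ₀ : #Z₀ ≤ 2 * q := by
    have hfne : f ≠ 0 := fun h0 => hf0 (by rw [h0, coeff_zero])
    refine le_trans ?_ (hdeg ▸ (card_roots' f))
    refine le_trans (card_le_card (t := f.roots.toFinset) ?_) (Multiset.toFinset_card_le _)
    intro z hz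
    rw [Multiset.mem_toFinset, mem_roots hfne]
    exact (mem_filter.1 hz).2
  have hcover : (2 * h + 1) ^ 2 ≤ #W + #Z + #Z₀ := by
    rw [← hcard, ← card_univ]
    refine le_trans (card_le_card (t := W ∪ Z ∪ Z₀) ?_)
      ((card_union_le _ _).trans (Nat.add_le_add_right (card_union_le _ _) _))
    intro z _
    simp only [mem_union, hWdef, hZdef, hZ₀def, mem_filter, mem_univ, true_and]
    by_cases hz : f.eval z = 0
    · exact Or.inr hz
    have hdiv : Fintype.card L / 2 = 2 * h * (h + 1) := by
      rw [hcard, show (2 * h + 1) ^ 2 = 2 * (2 * h * (h + 1)) + 1 by ring]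
      omega
    rcases FiniteField.pow_dichotomy h2 hz with h1 | h1
    · exact Or.inl (Or.inl ⟨hz, (FiniteField.isSquare_iff h2 hz).2 h1⟩)
    · rw [hdiv] at h1
      exact Or.inl (Or.inr h1)
  have hWT : 2 * #W ≤ #T := by
    have := mul_card_image_le_card_of_maps_to (s := T.filter fun x => x.2 ∈ W) (t := W)
      (f := Prod.snd) (fun x hx => (mem_filter.1 hx).2) 2 ?_
    · exact this.trans (card_filter_le _ _)
    intro z hz
    obtain ⟨hz0, w, hw⟩ := (mem_filter.1 hz).2
    rw [hfev] at hz0 hw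
    have hw0 : w ≠ 0 := by rintro rfl; exact hz0 (by rw [hw, zero_mul])
    set u := z ^ q - z with hu
    have hroot : ∀ w : L, u ^ 2 - c = w * w →
        (u + w) / (2 * α) ≠ 0 ∧
          α * ((u + w) / (2 * α)) + β * ((u + w) / (2 * α))⁻¹ = u := by
      intro w hw
      have hne : u + w ≠ 0 := by
        intro h0
        apply hc0
        have : w = -u := by linear_combination h0
        rw [this] at hw
        linear_combination -hw
      refine ⟨div_ne_zero hne (mul_ne_zero h20 hα), ?_⟩
      field_simp
      rw [hc] at hw
      linear_combination -hw
    obtain ⟨h11, h12⟩ := hroot w hw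
    obtain ⟨h21, h22⟩ := hroot (-w) (by rw [hw]; ring)
    have hne : ((u + w) / (2 * α), z) ≠ ((u + -w) / (2 * α), z) := by
      intro h0
      have h1 := (Prod.ext_iff.1 h0).1
      simp only at h1
      field_simp at h1
      have : 2 * w = 0 := by linear_combination h1
      exact (mul_ne_zero h20 hw0) this
    rw [← card_pair hne]
    refine card_le_card ?_
    intro x hx
    rw [mem_insert, mem_singleton] at hx
    simp only [mem_filter, mem_univ, true_and, hT]
    rcases hx with rfl | rfl
    · exact ⟨⟨⟨h11, h12⟩, hz⟩, rfl⟩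
    · exact ⟨⟨⟨h21, h22⟩, hz⟩, rfl⟩
  have hZ' : 2 * #Z ≤ (2 * h + 1) ^ 2 + (4 * q + 4) * (2 * h + 1) := by
    refine Nat.le_of_mul_le_mul_right ?_ (by omega : 0 < 2 * h + 1)
    nlinarith
  nlinarith

/-- The number of `z` with `z ^ q - z = u` is at most `q`, and `u` is in the kernel of `τ` if
there is one. -/
lemma card_mul_add_div_eq_le {k : Type*} [AddCommGroup k] (hq1 : 1 < q) (τ : L →+ k)
    (hτ : ∀ z, τ (z ^ q) = τ z) (α β : L) :
    #{x : L × L | x.1 ≠ 0 ∧ α * x.1 + β * x.1⁻¹ = x.2 ^ q - x.2}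
      ≤ q * #{x : L | x ≠ 0 ∧ τ (α * x + β * x⁻¹) = 0} := by
  refine card_le_mul_card_image_of_maps_to (f := Prod.fst) ?_ q ?_
  · intro x hx
    simp only [mem_filter, mem_univ, true_and] at hx ⊢
    refine ⟨hx.1, ?_⟩
    rw [hx.2, map_sub, hτ, sub_self]
  · intro x _
    set u := α * x + β * x⁻¹ with hu
    have hdeg : (X ^ q - X - C u : L[X]).natDegree = q := by
      rw [natDegree_sub_C, FiniteField.X_pow_card_sub_X_natDegree_eq L hq1]
    have hne : (X ^ q - X - C u : L[X]) ≠ 0 := by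
      intro h0; rw [h0, natDegree_zero] at hdeg; omega
    refine le_trans (card_le_card_of_injOn Prod.snd
      (t := (X ^ q - X - C u : L[X]).roots.toFinset) ?_ ?_)
      ((Multiset.toFinset_card_le _).trans ((card_roots' _).trans hdeg.le))
    · intro y hy
      simp only [coe_filter, mem_filter, mem_univ, true_and, Set.mem_ofPred_eq] at hy
      obtain ⟨⟨_, hy⟩, rfl⟩ := hy
      rw [mem_coe, Multiset.mem_toFinset, mem_roots hne]
      simp [IsRoot, hu, hy]
    · intro y hy y' hy' hyy
      simp only [coe_filter, mem_filter, mem_univ, true_and, Set.mem_ofPred_eq] at hy hy'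
      exact Prod.ext (hy.2.trans hy'.2.symm) hyy

end ArtinSchreier

section Weil

variable {k : Type} [Field k] [Fintype k]

lemma card_mul_card_kernel_eq {L : Type*} [Field L] [Fintype L] {ψ : AddChar k ℂ} (hψ : ψ ≠ 1)
    (τ : L →+ k) (α β : L) :
    (Fintype.card k * #{x : L | x ≠ 0 ∧ τ (α * x + β * x⁻¹) = 0} : ℂ)
      = ((Fintype.card L : ℂ) - 1)
        + ∑ s : k with s ≠ 0, kloosterman ((ψ.mulShift s).compAddMonoidHom τ) α β := by
  have h0 : kloosterman ((ψ.mulShift 0).compAddMonoidHom τ) α β = (Fintype.card L : ℂ) - 1 := by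
    rw [kloosterman]
    simp only [AddChar.compAddMonoidHom_apply, AddChar.mulShift_apply, zero_mul,
      AddChar.map_zero_eq_one, sum_const, nsmul_eq_mul, mul_one]
    rw [filter_ne', card_erase_of_mem (mem_univ _), card_univ, Nat.cast_sub Fintype.card_pos,
      Nat.cast_one]
  rw [← h0, filter_ne', add_sum_erase univ
    (fun s => kloosterman ((ψ.mulShift s).compAddMonoidHom τ) α β) (mem_univ 0)]
  simp only [kloosterman, AddChar.compAddMonoidHom_apply, AddChar.mulShift_apply]
  rw [sum_comm]
  have := fun t => AddChar.sum_mulShift t (AddChar.IsPrimitive.of_ne_one hψ)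
  simp only [this]
  rw [← filter_filter, card_filter, Nat.cast_sum, mul_sum]
  refine sum_congr rfl fun x _ => ?_
  split_ifs <;> simp

lemma sum_kloostermanTower_ge {q : ℕ} (hodd : Odd q) (hk : Fintype.card k = q)
    {ψ : AddChar k ℂ} (hψ : ψ ≠ 1) {a b : k} (ha : a ≠ 0) (hb : b ≠ 0) (i : ℕ) :
    -((8 * q + 4) * (q : ℝ) ^ 2 ^ (i + 1)) ≤
      ∑ s : k with s ≠ 0, kloostermanTower q (kloosterman (ψ.mulShift s) a b).re (i + 2) := by
  obtain ⟨L, _, _, τ, α, β, hL, -, hτq, hα, hβ, hT⟩ :=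
    exists_field_kloosterman_eq hodd hk hψ ha hb (i + 2)
  have hq1 : 1 < q := hk ▸ Fintype.one_lt_card
  have hq3 : 3 ≤ q := by obtain ⟨m, rfl⟩ := hodd; omega
  have hn : 2 ^ (i + 2) ≠ 0 := pow_ne_zero _ two_ne_zero
  obtain ⟨p, e, hp, hchar, he⟩ := exists_prime_charP_eq_pow hn hL
  have : ExpChar L p := ExpChar.prime hp
  obtain ⟨h, hh⟩ : Odd (q ^ 2 ^ (i + 1)) := hodd.pow
  have hq0 : (q : L) = 0 := by
    have : (Fintype.card L : L) = 0 := Nat.cast_card_eq_zero L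
    rw [hL, Nat.cast_pow] at this
    exact eq_zero_of_pow_eq_zero this
  have hcard : Fintype.card L = (2 * h + 1) ^ 2 := by
    rw [hL, ← hh, ← pow_mul, ← pow_succ]
  have hqh : q < h := by
    have : q ^ 2 ≤ 2 * h + 1 := by
      rw [← hh]
      refine Nat.pow_le_pow_right (by omega) ?_
      rw [pow_succ]
      have := Nat.one_le_two_pow (n := i)
      omega
    nlinarith
  have h1 := card_le_card_mul_add_div_eq (h := h) (p := p) (e := e * 2 ^ (i + 1))
    (by rw [← hh, he, ← pow_mul]) hcard hq1 hqh hq0 (ringChar_ne_two_of_card_eq_pow hodd hL) hα hβ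
  have h2 := card_mul_add_div_eq_le hq1 τ hτq α β
  have h3 := card_mul_card_kernel_eq hψ τ α β
  rw [sum_congr rfl fun s hs => hT s (mem_filter.1 hs).2, ← Complex.ofReal_sum, hcard, hk] at h3
  have h4 : (q * #{x : L | x ≠ 0 ∧ τ (α * x + β * x⁻¹) = 0} : ℝ) = ((2 * h + 1 : ℕ) : ℝ) ^ 2 - 1
      + ∑ s : k with s ≠ 0, kloostermanTower q (kloosterman (ψ.mulShift s) a b).re (i + 2) := by
    apply Complex.ofReal_injective
    push_cast at h3 ⊢
    exact h3
  have h5 : ((2 * h + 1 : ℕ) : ℝ) ^ 2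
      ≤ q * #{x : L | x ≠ 0 ∧ τ (α * x + β * x⁻¹) = 0} + (8 * q + 4) * ((2 * h + 1 : ℕ) : ℝ) := by
    exact_mod_cast h1.trans (Nat.add_le_add_right h2 _)
  have h6 : (q : ℝ) ^ 2 ^ (i + 1) = ((2 * h + 1 : ℕ) : ℝ) := by exact_mod_cast hh
  rw [h6]
  linarith

lemma four_add_mul_le_kloostermanTower_sq {q : ℕ} {K ε : ℝ} (hε : 0 ≤ ε)
    (hK : (4 + ε) * q ≤ K ^ 2) (i : ℕ) :
    (4 + 4 ^ i * ε) * (q : ℝ) ^ 2 ^ i ≤ kloostermanTower q K i ^ 2 := by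
  induction i with
  | zero => simpa [kloostermanTower] using hK
  | succ i ih =>
    rw [kloostermanTower]
    set Q := (q : ℝ) ^ 2 ^ i
    set t := kloostermanTower q K i
    have hQ : (q : ℝ) ^ 2 ^ (i + 1) = Q ^ 2 := by rw [pow_succ, pow_mul]
    have hQ0 : 0 ≤ Q := by positivity
    rw [hQ]
    have he : 0 ≤ 4 ^ i * ε := by positivity
    have h1 : (2 + 4 ^ i * ε) * Q ≤ t ^ 2 - 2 * Q := by linarith
    have h2 : ((2 + 4 ^ i * ε) * Q) ^ 2 ≤ (t ^ 2 - 2 * Q) ^ 2 :=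
      pow_le_pow_left₀ (by positivity) h1 2
    calc (4 + 4 ^ (i + 1) * ε) * Q ^ 2 ≤ ((2 + 4 ^ i * ε) * Q) ^ 2 := by
          rw [mul_pow]
          refine mul_le_mul_of_nonneg_right ?_ (by positivity)
          rw [pow_succ]
          nlinarith
      _ ≤ _ := h2
      _ = _ := by ring

/-- Weil's bound for Kloosterman sums. -/
theorem kloosterman_re_sq_le {q : ℕ} (hodd : Odd q) (hk : Fintype.card k = q)
    {ψ : AddChar k ℂ} (hψ : ψ ≠ 1) {a b : k} (ha : a ≠ 0) (hb : b ≠ 0) :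
    (kloosterman ψ a b).re ^ 2 ≤ 4 * q := by
  by_contra! hlt
  have hq0 : (0 : ℝ) < q := by
    have : 0 < q := hk ▸ Fintype.card_pos
    exact_mod_cast this
  set K := (kloosterman ψ a b).re with hK
  set ε := (K ^ 2 - 4 * q) / q with hε
  have hε0 : 0 < ε := div_pos (by linarith) hq0
  have hεK : (4 + ε) * q ≤ K ^ 2 := by rw [hε]; field_simp; linarith
  obtain ⟨i, hi⟩ := pow_unbounded_of_one_lt ((10 * q + 4) / ε) (by norm_num : (1 : ℝ) < 4)
  have h1 := sum_kloostermanTower_ge hodd hk hψ ha hb i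
  have hmem : (1 : k) ∈ ({s : k | s ≠ 0} : Finset k) := by simp
  rw [← add_sum_erase _ _ hmem, AddChar.mulShift_one, ← hK] at h1
  set Q := (q : ℝ) ^ 2 ^ (i + 1) with hQ
  have hQ0 : 0 < Q := by positivity
  have h2 : kloostermanTower q K (i + 2) ≤ -((2 + 4 ^ (i + 1) * ε) * Q) := by
    have := four_add_mul_le_kloostermanTower_sq hε0.le hεK (i + 1)
    rw [kloostermanTower, ← hQ]
    linarith
  have h3 : ∑ s ∈ ({s : k | s ≠ 0} : Finset k).erase 1,
      kloostermanTower q (kloosterman (ψ.mulShift s) a b).re (i + 2) ≤ q * (2 * Q) := by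
    refine (sum_le_card_nsmul _ _ (2 * Q) fun s _ => ?_).trans ?_
    · rw [kloostermanTower, ← hQ]
      have := sq_nonneg (kloostermanTower q (kloosterman (ψ.mulShift s) a b).re (i + 1))
      linarith
    · rw [nsmul_eq_mul]
      refine mul_le_mul_of_nonneg_right ?_ (by positivity)
      rw [← hk]
      exact_mod_cast card_le_univ _
  have h4 : (10 * q + 4) < 4 ^ i * ε := by rwa [div_lt_iff₀ hε0] at hi
  have h5 : (10 * q + 4) < 4 ^ (i + 1) * ε := by
    rw [pow_succ]
    have : 0 < 4 ^ i * ε := by positivity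
    linarith
  have h6 := mul_lt_mul_of_pos_right h5 hQ0
  nlinarith

theorem norm_kloosterman_le {q : ℕ} (hodd : Odd q) (hk : Fintype.card k = q)
    {ψ : AddChar k ℂ} (hψ : ψ ≠ 1) {a b : k} (ha : a ≠ 0) (hb : b ≠ 0) :
    ‖kloosterman ψ a b‖ ≤ 2 * √q := by
  rw [← ofReal_re_kloosterman, Complex.norm_real, Real.norm_eq_abs]
  apply abs_le_of_sq_le_sq _ (by positivity)
  rw [mul_pow, Real.sq_sqrt (Nat.cast_nonneg _)]
  have := kloosterman_re_sq_le hodd hk hψ ha hb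
  linarith

end Weil

section QuadraticSums

variable {F : Type} [Field F] [Fintype F]

/-- The quadratic character, with complex values. -/
noncomputable def complexQuadraticChar (F : Type) [Field F] [Fintype F] : MulChar F ℂ :=
  (quadraticChar F).ringHomComp (Int.castRingHom ℂ)

lemma complexQuadraticChar_apply (t : F) :
    complexQuadraticChar F t = ((quadraticChar F t : ℤ) : ℂ) := rfl

lemma complexQuadraticChar_isQuadratic : (complexQuadraticChar F).IsQuadratic :=
  (quadraticChar_isQuadratic F).comp _

lemma complexQuadraticChar_ne_one (h2 : ringChar F ≠ 2) : complexQuadraticChar F ≠ 1 :=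
  (MulChar.ringHomComp_ne_one_iff (Int.castRingHom ℂ).injective_int).2 (quadraticChar_ne_one h2)

lemma complexQuadraticChar_sq {t : F} (ht : t ≠ 0) : complexQuadraticChar F t ^ 2 = 1 := by
  rw [complexQuadraticChar_apply]
  exact_mod_cast quadraticChar_sq_one ht

lemma norm_complexQuadraticChar {t : F} (ht : t ≠ 0) : ‖complexQuadraticChar F t‖ = 1 := by
  have h := congrArg norm (complexQuadraticChar_sq ht)
  rw [norm_pow, norm_one] at h
  exact (pow_eq_one_iff_of_nonneg (norm_nonneg _) two_ne_zero).1 h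

lemma norm_gaussSum_sq (h2 : ringChar F ≠ 2) {ψ : AddChar F ℂ} (hψ : ψ ≠ 1) :
    ‖gaussSum (complexQuadraticChar F) ψ‖ ^ 2 = Fintype.card F := by
  rw [← norm_pow, gaussSum_sq (complexQuadraticChar_ne_one h2) complexQuadraticChar_isQuadratic
    (AddChar.IsPrimitive.of_ne_one hψ), norm_mul, norm_complexQuadraticChar (by simp), one_mul,
    Complex.norm_natCast]

lemma sum_addChar_mul_sq (h2 : ringChar F ≠ 2) {ψ : AddChar F ℂ} (hψ : ψ ≠ 1) {t : F}
    (ht : t ≠ 0) :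
    ∑ x, ψ (t * x ^ 2) = complexQuadraticChar F t * gaussSum (complexQuadraticChar F) ψ := by
  have h := gaussSum_mulShift (complexQuadraticChar F) ψ (Units.mk0 t ht)
  rw [Units.val_mk0] at h
  rw [← h, ← mul_assoc, ← sq, complexQuadraticChar_sq ht, one_mul]
  have h0 : ∑ e, ψ (t * e) = 0 := by
    have := AddChar.sum_eq_zero_of_ne_one (AddChar.IsPrimitive.of_ne_one hψ ht)
    simpa only [AddChar.mulShift_apply] using this
  calc ∑ x, ψ (t * x ^ 2) = ∑ e, (complexQuadraticChar F e + 1) * ψ (t * e) := by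
        rw [← sum_fiberwise univ (fun x : F => x ^ 2)]
        refine sum_congr rfl fun e _ => ?_
        rw [sum_congr rfl (g := fun _ => ψ (t * e)) (fun x hx => by rw [(mem_filter.1 hx).2]),
          sum_const, nsmul_eq_mul, complexQuadraticChar_apply]
        congr 1
        have := quadraticChar_card_sqrts h2 e
        have h' : #{x : F | x ^ 2 = e} = #({x : F | x ^ 2 = e} : Set F).toFinset := by
          congr 1; ext; simp
        rw [h']
        exact_mod_cast this
    _ = _ := by
        simp only [add_mul, one_mul, sum_add_distrib, h0, add_zero, gaussSum,
          AddChar.mulShift_apply]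

lemma card_mul_sum_addChar_polar {V : Type*} [AddCommGroup V] [Module F V] [Fintype V]
    {ψ : AddChar F ℂ} (hψ : ψ ≠ 1) (Q : QuadraticForm F V) (a : F) {b y : V}
    (hb : QuadraticMap.polar Q b y ≠ 0) :
    (Fintype.card F : ℂ) * ∑ x with Q x = a, ψ (QuadraticMap.polar Q b x) =
      ∑ t : F with t ≠ 0, (∑ x, ψ (t * Q x)) * ψ (-a * t + -Q b * t⁻¹) := by
  have hprim := AddChar.IsPrimitive.of_ne_one hψ
  have h0 : ∑ x, ψ (QuadraticMap.polar Q b x) = 0 := by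
    obtain ⟨s, hs⟩ := AddChar.ne_one_iff.1 hψ
    refine AddChar.sum_eq_zero_of_ne_one
      (ψ := ψ.compAddMonoidHom (QuadraticMap.polarBilin Q b).toAddMonoidHom)
      (AddChar.ne_one_iff.2 ⟨(s / QuadraticMap.polar Q b y) • y, ?_⟩)
    simp only [AddChar.compAddMonoidHom_apply, LinearMap.toAddMonoidHom_coe,
      QuadraticMap.polarBilin_apply_apply, map_smul, smul_eq_mul]
    rwa [div_mul_cancel₀ _ hb]
  calc (Fintype.card F : ℂ) * ∑ x with Q x = a, ψ (QuadraticMap.polar Q b x)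
      = ∑ x, ∑ t, ψ (t * (Q x - a)) * ψ (QuadraticMap.polar Q b x) := by
        rw [sum_filter, mul_sum]
        refine sum_congr rfl fun x _ => ?_
        rw [← sum_mul, AddChar.sum_mulShift _ hprim]
        simp only [sub_eq_zero]
        split_ifs <;> simp
    _ = ∑ t, ∑ x, ψ (t * (Q x - a)) * ψ (QuadraticMap.polar Q b x) := sum_comm
    _ = ∑ t with t ≠ 0, ∑ x, ψ (t * (Q x - a)) * ψ (QuadraticMap.polar Q b x) := by
        rw [sum_filter_of_ne]
        rintro t - ht rfl
        exact ht (by simpa using h0)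
    _ = _ := by
        refine sum_congr rfl fun t ht => ?_
        have ht : t ≠ 0 := (mem_filter.1 ht).2
        rw [← Equiv.sum_comp (Equiv.addRight (t⁻¹ • b)) (fun x => ψ (t * Q x)), sum_mul]
        refine sum_congr rfl fun x _ => ?_
        rw [← AddChar.map_add_eq_mul, ← AddChar.map_add_eq_mul, Equiv.coe_addRight,
          QuadraticMap.map_add Q, QuadraticMap.map_smul, QuadraticMap.polar_smul_right,
          QuadraticMap.polar_comm Q x b]
        congr 1
        simp only [smul_eq_mul]
        field_simp
        ring

lemma addChar_sum {A M ι : Type*} [AddCommMonoid A] [CommMonoid M] (ψ : AddChar A M)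
    (s : Finset ι) (f : ι → A) : ψ (∑ i ∈ s, f i) = ∏ i ∈ s, ψ (f i) := by
  simpa [← ofAdd_sum] using map_prod ψ.toMonoidHom (fun i => Multiplicative.ofAdd (f i)) s

lemma exists_sum_addChar_quadraticForm (h2 : ringChar F ≠ 2) {ψ : AddChar F ℂ} (hψ : ψ ≠ 1)
    {V : Type*} [AddCommGroup V] [Module F V] [Fintype V] (Q : QuadraticForm F V)
    (hQ : ∀ x, (∀ y, QuadraticMap.polar Q x y = 0) → x = 0) :
    ∃ C : ℂ, ‖C‖ ^ 2 = (Fintype.card F : ℝ) ^ Module.finrank F V ∧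
      ∀ t : F, t ≠ 0 →
        ∑ x, ψ (t * Q x) = C * complexQuadraticChar F t ^ Module.finrank F V := by
  have : Invertible (2 : F) := invertibleOfNonzero (Ring.two_ne_zero h2)
  obtain ⟨w, ⟨e⟩⟩ := QuadraticForm.equivalent_weightedSumSquares_units_of_nondegenerate' Q (by
    intro x hx
    refine hQ x fun y => ?_
    rw [← QuadraticMap.polarBilin_apply_apply, ← QuadraticMap.two_nsmul_associated F Q]
    simp only [LinearMap.smul_apply, hx y, smul_zero])
  refine ⟨∏ i, complexQuadraticChar F (w i) * gaussSum (complexQuadraticChar F) ψ, ?_, ?_⟩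
  · rw [norm_prod, ← prod_pow, prod_congr rfl (g := fun _ => (Fintype.card F : ℝ)), prod_const,
      card_univ, Fintype.card_fin]
    intro i _
    rw [norm_mul, norm_complexQuadraticChar (w i).ne_zero, one_mul, norm_gaussSum_sq h2 hψ]
  · intro t ht
    calc ∑ x, ψ (t * Q x) = ∑ y : Fin _ → F, ψ (t * ∑ i, w i * (y i * y i)) := by
          rw [← Equiv.sum_comp e.toLinearEquiv.toEquiv]
          refine sum_congr rfl fun x _ => ?_
          rw [← e.map_app x, QuadraticMap.weightedSumSquares_apply]
          rfl
      _ = ∏ i, ∑ y, ψ (t * w i * y ^ 2) := by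
          rw [prod_univ_sum, Fintype.piFinset_univ]
          refine sum_congr rfl fun y _ => ?_
          rw [← addChar_sum, mul_sum]
          congr 1
          exact sum_congr rfl fun i _ => by ring
      _ = _ := by
          simp only [sum_addChar_mul_sq h2 hψ (mul_ne_zero ht (Units.ne_zero _)), map_mul,
            prod_mul_distrib, prod_const, card_univ, Fintype.card_fin]
          ring

lemma norm_salie_le {q : ℕ} (hF : Fintype.card F = q) (h2 : ringChar F ≠ 2) {ψ : AddChar F ℂ}
    (hψ : ψ ≠ 1) (a : F) {c : F} (hc : c ≠ 0) :
    ‖∑ t : F with t ≠ 0, complexQuadraticChar F t * ψ (-a * t + -c * t⁻¹)‖ ≤ 2 * √q := by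
  have h20 : (2 : F) ≠ 0 := Ring.two_ne_zero h2
  have hpol : ∀ x : F, QuadraticMap.polar (c • QuadraticMap.sq : QuadraticForm F F) 1 x
      = 2 * c * x := by
    intro x
    simp only [QuadraticMap.polar, _root_.smul_apply, QuadraticMap.sq_apply, smul_eq_mul]
    ring
  have h := card_mul_sum_addChar_polar hψ (c • QuadraticMap.sq : QuadraticForm F F) a (b := 1)
    (y := 1) (by rw [hpol, mul_one]; exact mul_ne_zero h20 hc)
  have hg := norm_gaussSum_sq h2 hψ
  have hS : ∑ t : F with t ≠ 0,
      (∑ x, ψ (t * (c • QuadraticMap.sq : QuadraticForm F F) x)) *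
        ψ (-a * t + -(c • QuadraticMap.sq : QuadraticForm F F) 1 * t⁻¹)
      = complexQuadraticChar F c * gaussSum (complexQuadraticChar F) ψ *
        ∑ t : F with t ≠ 0, complexQuadraticChar F t * ψ (-a * t + -c * t⁻¹) := by
    rw [mul_sum]
    refine sum_congr rfl fun t ht => ?_
    have ht : t ≠ 0 := (mem_filter.1 ht).2
    simp only [_root_.smul_apply, QuadraticMap.sq_apply, smul_eq_mul, ← sq,
      ← mul_assoc t c]
    rw [sum_addChar_mul_sq h2 hψ (mul_ne_zero ht hc), map_mul, one_pow, mul_one]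
    ring
  rw [hS] at h
  have hcount : #{x : F | (c • QuadraticMap.sq : QuadraticForm F F) x = a} ≤ 2 := by
    by_cases h0 : ∃ x₀ : F, c * x₀ ^ 2 = a
    · obtain ⟨x₀, hx₀⟩ := h0
      refine (card_le_card (t := {x₀, -x₀}) ?_).trans card_le_two
      intro x hx
      have hx : c * (x * x) = a := (mem_filter.1 hx).2
      rw [mem_insert, mem_singleton]
      refine sq_eq_sq_iff_eq_or_eq_neg.1 (mul_left_cancel₀ hc ?_)
      rw [hx₀, ← hx, sq]
    · push Not at h0
      rw [filter_false_of_mem, card_empty]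
      · norm_num
      · intro x _ hx
        have hx : c * (x * x) = a := hx
        exact h0 x (by rw [sq, hx])
  have h3 := congrArg norm h
  rw [norm_mul, norm_mul, norm_mul, norm_complexQuadraticChar hc, one_mul, Complex.norm_natCast,
    hF] at h3
  rw [hF] at hg
  have hq0 : (0 : ℝ) < q := by
    have : 0 < q := hF ▸ Fintype.card_pos
    exact_mod_cast this
  have hg' : ‖gaussSum (complexQuadraticChar F) ψ‖ = √q := by rw [← hg, Real.sqrt_sq (norm_nonneg _)]
  have h4 : ‖∑ x : F with (c • QuadraticMap.sq : QuadraticForm F F) x = a,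
      ψ (QuadraticMap.polar (c • QuadraticMap.sq : QuadraticForm F F) 1 x)‖ ≤ 2 := by
    refine (norm_sum_le _ _).trans ?_
    simp only [AddChar.norm_apply, sum_const, nsmul_eq_mul, mul_one]
    exact_mod_cast hcount
  have hs : √(q : ℝ) * √q = q := Real.mul_self_sqrt hq0.le
  have hs0 : 0 < √(q : ℝ) := Real.sqrt_pos.2 hq0
  refine le_of_mul_le_mul_left ?_ hs0
  rw [← hg', ← h3, hg']
  calc (q : ℝ) * _ ≤ q * 2 := mul_le_mul_of_nonneg_left h4 hq0.le
    _ = _ := by nth_rw 1 [← hs]; ring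

lemma norm_sum_quadraticChar_pow_mul_le {q : ℕ} (hodd : Odd q) (hF : Fintype.card F = q)
    (h2 : ringChar F ≠ 2) {ψ : AddChar F ℂ} (hψ : ψ ≠ 1) {a : F} (ha : a ≠ 0) (c : F) (d : ℕ) :
    ‖∑ t : F with t ≠ 0, complexQuadraticChar F t ^ d * ψ (-a * t + -c * t⁻¹)‖ ≤ 2 * √q := by
  have hq1 : 1 ≤ √(q : ℝ) := by
    rw [Real.one_le_sqrt]
    have : 1 ≤ q := hF ▸ Fintype.card_pos
    exact_mod_cast this
  rcases Nat.even_or_odd' d with ⟨m, rfl | rfl⟩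
  · have h1 : ∑ t : F with t ≠ 0, complexQuadraticChar F t ^ (2 * m) * ψ (-a * t + -c * t⁻¹)
        = kloosterman ψ (-a) (-c) := by
      refine sum_congr rfl fun t ht => ?_
      rw [pow_mul, complexQuadraticChar_sq (mem_filter.1 ht).2, one_pow, one_mul]
    rw [h1]
    rcases eq_or_ne c 0 with rfl | hc
    · have h0 := AddChar.sum_eq_zero_of_ne_one
        (AddChar.IsPrimitive.of_ne_one hψ (neg_ne_zero.2 ha))
      rw [← add_sum_erase _ _ (mem_univ 0), AddChar.map_zero_eq_one, ← filter_ne'] at h0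
      have : kloosterman ψ (-a) (-0) = -1 := by
        simp only [AddChar.mulShift_apply] at h0
        simp only [kloosterman, neg_zero, zero_mul, add_zero]
        linear_combination h0
      rw [this, norm_neg, norm_one]
      linarith
    · exact norm_kloosterman_le hodd hF hψ (neg_ne_zero.2 ha) (neg_ne_zero.2 hc)
  · have h1 : ∑ t : F with t ≠ 0, complexQuadraticChar F t ^ (2 * m + 1) * ψ (-a * t + -c * t⁻¹)
        = ∑ t : F with t ≠ 0, complexQuadraticChar F t * ψ (-a * t + -c * t⁻¹) := by
      refine sum_congr rfl fun t ht => ?_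
      rw [pow_succ, pow_mul, complexQuadraticChar_sq (mem_filter.1 ht).2, one_pow, one_mul]
    rw [h1]
    rcases eq_or_ne c 0 with rfl | hc
    · have : ∑ t : F with t ≠ 0, complexQuadraticChar F t * ψ (-a * t + -0 * t⁻¹)
          = gaussSum (complexQuadraticChar F) (ψ.mulShift (-a)) := by
        rw [sum_filter_of_ne]
        · simp [gaussSum, AddChar.mulShift_apply]
        · rintro t - ht rfl
          exact ht (by rw [MulChar.map_zero, zero_mul])
      have hg := norm_gaussSum_sq h2 (AddChar.IsPrimitive.of_ne_one hψ (neg_ne_zero.2 ha))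
      rw [this, ← Real.sqrt_sq (norm_nonneg (gaussSum _ _)), hg, hF]
      linarith
    · exact norm_salie_le hF h2 hψ a hc

/-- Bound for the Fourier coefficients of a sphere `Q = a`. -/
lemma norm_sum_addChar_polar_sq_le {q : ℕ} (hodd : Odd q) (hF : Fintype.card F = q)
    {ψ : AddChar F ℂ} (hψ : ψ ≠ 1) {V : Type*} [AddCommGroup V] [Module F V] [Fintype V]
    (Q : QuadraticForm F V) (hQ : ∀ x, (∀ y, QuadraticMap.polar Q x y = 0) → x = 0) {a : F}
    (ha : a ≠ 0) {b : V} (hb : b ≠ 0) :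
    q * ‖∑ x with Q x = a, ψ (QuadraticMap.polar Q b x)‖ ^ 2
      ≤ 4 * (q : ℝ) ^ Module.finrank F V := by
  have h2 : ringChar F ≠ 2 := ringChar_ne_two_of_card_eq_pow (n := 1) hodd (by rw [hF, pow_one])
  obtain ⟨y, hy⟩ : ∃ y, QuadraticMap.polar Q b y ≠ 0 := by
    by_contra! h
    exact hb (hQ b h)
  have h := card_mul_sum_addChar_polar hψ Q a hy
  obtain ⟨C, hC, hCt⟩ := exists_sum_addChar_quadraticForm h2 hψ Q hQ
  rw [sum_congr rfl (g := fun t => C * (complexQuadraticChar F t ^ Module.finrank F V *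
    ψ (-a * t + -Q b * t⁻¹))) (fun t ht => by rw [hCt t (mem_filter.1 ht).2, mul_assoc]),
    ← mul_sum] at h
  have h1 := congrArg (fun z => ‖z‖ ^ 2) h
  simp only [norm_mul, mul_pow, hC, Complex.norm_natCast, hF] at h1
  have hq0 : (0 : ℝ) < q := by
    have : 0 < q := hF ▸ Fintype.card_pos
    exact_mod_cast this
  have h3 := pow_le_pow_left₀ (norm_nonneg _)
    (norm_sum_quadraticChar_pow_mul_le hodd hF h2 hψ ha (Q b) (Module.finrank F V)) 2
  rw [mul_pow, Real.sq_sqrt hq0.le] at h3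
  refine le_of_mul_le_mul_left ?_ hq0
  calc _ = (q : ℝ) ^ 2 * ‖∑ x with Q x = a, ψ (QuadraticMap.polar Q b x)‖ ^ 2 := by ring
    _ = _ := h1
    _ ≤ _ := mul_le_mul_of_nonneg_left h3 (by positivity)
    _ = _ := by ring

end QuadraticSums

section Fourier

variable {F : Type*} [Field F] {V : Type*} [AddCommGroup V] [Module F V] [Fintype V]

/-- The Fourier transform of `v` with respect to the pairing `ψ (polar Q b x)`. -/
noncomputable def polarFourier (ψ : AddChar F ℂ) (Q : QuadraticForm F V) (v : V → ℝ) (b : V) : ℂ :=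
  ∑ x, v x * ψ (QuadraticMap.polar Q b x)

lemma polarFourier_zero (ψ : AddChar F ℂ) (Q : QuadraticForm F V) (v : V → ℝ) :
    polarFourier ψ Q v 0 = ((∑ x, v x : ℝ) : ℂ) := by
  simp [polarFourier, QuadraticMap.polar_zero_left]

lemma sum_addChar_polar {ψ : AddChar F ℂ} (hψ : ψ ≠ 1) {Q : QuadraticForm F V}
    (hQ : ∀ x, (∀ y, QuadraticMap.polar Q x y = 0) → x = 0) (x : V) :
    ∑ b, ψ (QuadraticMap.polar Q b x) = if x = 0 then (Fintype.card V : ℂ) else 0 := by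
  split_ifs with hx
  · simp [hx, QuadraticMap.polar_zero_right]
  · obtain ⟨s, hs⟩ := AddChar.ne_one_iff.1 hψ
    obtain ⟨y, hy⟩ : ∃ y, QuadraticMap.polar Q x y ≠ 0 := by
      by_contra! h
      exact hx (hQ x h)
    simp only [QuadraticMap.polar_comm Q _ x]
    refine AddChar.sum_eq_zero_of_ne_one
      (ψ := ψ.compAddMonoidHom (QuadraticMap.polarBilin Q x).toAddMonoidHom)
      (AddChar.ne_one_iff.2 ⟨(s / QuadraticMap.polar Q x y) • y, ?_⟩)
    simp only [AddChar.compAddMonoidHom_apply, LinearMap.toAddMonoidHom_coe,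
      QuadraticMap.polarBilin_apply_apply, map_smul, smul_eq_mul]
    rwa [div_mul_cancel₀ _ hy]

lemma sum_norm_polarFourier_sq [Finite F] {ψ : AddChar F ℂ} (hψ : ψ ≠ 1) {Q : QuadraticForm F V}
    (hQ : ∀ x, (∀ y, QuadraticMap.polar Q x y = 0) → x = 0) (v : V → ℝ) :
    ∑ b, ‖polarFourier ψ Q v b‖ ^ 2 = Fintype.card V * ∑ x, v x ^ 2 := by
  apply Complex.ofReal_injective
  push_cast
  calc ∑ b, (‖polarFourier ψ Q v b‖ : ℂ) ^ 2
      = ∑ b, ∑ x, ∑ y, (v x * v y : ℂ) * ψ (QuadraticMap.polar Q b (x - y)) := by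
        refine sum_congr rfl fun b _ => ?_
        rw [← Complex.mul_conj', polarFourier, map_sum, sum_mul_sum]
        refine sum_congr rfl fun x _ => sum_congr rfl fun y _ => ?_
        rw [map_mul, Complex.conj_ofReal, ← AddChar.map_neg_eq_conj, sub_eq_add_neg,
          QuadraticMap.polar_add_right, QuadraticMap.polar_neg_right, AddChar.map_add_eq_mul]
        ring
    _ = ∑ x, ∑ y, (v x * v y : ℂ) * ∑ b, ψ (QuadraticMap.polar Q b (x - y)) := by
        rw [sum_comm]
        refine sum_congr rfl fun x _ => ?_
        rw [sum_comm]
        exact sum_congr rfl fun y _ => (mul_sum _ _ _).symm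
    _ = _ := by
        simp only [sum_addChar_polar hψ hQ, sub_eq_zero, mul_ite, mul_zero, sum_ite_eq, mem_univ,
          if_true]
        rw [mul_sum]
        exact sum_congr rfl fun x _ => by ring

lemma polarFourier_convolution (ψ : AddChar F ℂ) (Q : QuadraticForm F V) (a : F) (v : V → ℝ)
    (b : V) :
    polarFourier ψ Q (fun x => ∑ y with Q (x - y) = a, v y) b
      = (∑ x with Q x = a, ψ (QuadraticMap.polar Q b x)) * polarFourier ψ Q v b := by
  simp only [polarFourier]
  push_cast
  simp only [sum_filter, sum_mul, mul_sum]
  rw [sum_comm]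
  refine sum_congr rfl fun y _ => ?_
  rw [← Equiv.sum_comp (Equiv.addRight y)]
  refine sum_congr rfl fun x _ => ?_
  rw [Equiv.coe_addRight, add_sub_cancel_right, QuadraticMap.polar_add_right,
    AddChar.map_add_eq_mul]
  split_ifs
  · ring
  · simp

end Fourier

/-- Let `G` be the finite Euclidean graph on `𝔽_q^d` attached to a
nondegenerate quadratic form `Q` and `a ≠ 0` (adjacency: `x ≠ y` and `Q (x - y) = a`),
and let `A` be its real adjacency matrix. Then for every real vector `v` whose
coordinates sum to `0`, `‖A v‖ ≤ 2 q^((d-1)/2) ‖v‖` (Euclidean norms); i.e. every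
eigenvalue of `A` other than the valency has absolute value at most `2 q^((d-1)/2)`. -/
theorem euclidean_graph_spectral_gap (q d : ℕ) (hq : IsPrimePow q) (hodd : Odd q)
    (hd : 2 ≤ d)
    (K : Type) [Field K] [Fintype K] (hcard : Fintype.card K = q)
    (Q : QuadraticForm K (Fin d → K))
    (hQ : ∀ x : Fin d → K, (∀ y : Fin d → K, Q (x + y) - Q x - Q y = 0) → x = 0)
    (a : K) (ha : a ≠ 0)
    (G : SimpleGraph (Fin d → K))
    (hG : ∀ x y : Fin d → K, G.Adj x y ↔ (x ≠ y ∧ Q (x - y) = a))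
    (v : (Fin d → K) → ℝ) (hv : ∑ x, v x = 0) :
    Real.sqrt (∑ x, ((G.adjMatrix ℝ).mulVec v x) ^ 2)
      ≤ 2 * (q : ℝ) ^ (((d : ℝ) - 1) / 2) * Real.sqrt (∑ x, (v x) ^ 2) := by
  obtain ⟨ψ, hψ1⟩ := AddChar.exists_apply_ne_zero.2 (one_ne_zero (α := K))
  have hψ : ψ ≠ 1 := AddChar.ne_one_iff.2 ⟨1, hψ1⟩
  have hq0 : (0 : ℝ) < q := by exact_mod_cast hq.pos
  have hpow : (2 * (q : ℝ) ^ (((d : ℝ) - 1) / 2)) ^ 2 * q = 4 * (q : ℝ) ^ d := by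
    rw [mul_pow, ← Real.rpow_mul_natCast hq0.le, mul_assoc, ← Real.rpow_add_one hq0.ne',
      ← Real.rpow_natCast (q : ℝ) d]
    norm_num
  set M := 2 * (q : ℝ) ^ (((d : ℝ) - 1) / 2)
  have hM : 0 ≤ M := by positivity
  have hA : (G.adjMatrix ℝ).mulVec v = fun x => ∑ y with Q (x - y) = a, v y := by
    funext x
    rw [SimpleGraph.adjMatrix_mulVec_apply]
    refine sum_congr ?_ fun _ _ => rfl
    ext y
    simp only [SimpleGraph.mem_neighborFinset, hG, mem_filter, mem_univ, true_and,
      and_iff_right_iff_imp]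
    rintro h rfl
    exact ha (by rw [← h, sub_self, QuadraticMap.map_zero])
  have hcoeff : ∀ b, ‖polarFourier ψ Q ((G.adjMatrix ℝ).mulVec v) b‖ ^ 2
      ≤ M ^ 2 * ‖polarFourier ψ Q v b‖ ^ 2 := by
    intro b
    rw [hA, polarFourier_convolution, norm_mul, mul_pow]
    rcases eq_or_ne b 0 with rfl | hb
    · simp [polarFourier_zero, hv]
    · refine mul_le_mul_of_nonneg_right ?_ (by positivity)
      have h := norm_sum_addChar_polar_sq_le hodd hcard hψ Q hQ ha hb
      rw [Module.finrank_fin_fun, ← hpow, mul_comm (M ^ 2)] at h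
      exact le_of_mul_le_mul_left h hq0
  have hle := sum_le_sum fun b (_ : b ∈ univ) => hcoeff b
  rw [← mul_sum, sum_norm_polarFourier_sq hψ hQ, sum_norm_polarFourier_sq hψ hQ,
    mul_left_comm] at hle
  have hle := le_of_mul_le_mul_left hle (by exact_mod_cast Fintype.card_pos)
  rw [← Real.sqrt_sq hM, ← Real.sqrt_mul (sq_nonneg M)]
  exact Real.sqrt_le_sqrt hle
end
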